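/- arXiv:1004.4130 — 5 statements merged into one kernel-verified Lean document; each statement's English description precedes it below -/
import Mathlib

section
/- For every Ψ in the domain of X², the limit B(Ψ) := lim_{n→∞} ⟨Ψ, U^{-n} X² U^{n} Ψ⟩ / n² exists and is nonnegative. Moreover, B(Ψ) = 0 for every Ψ in the domain of X² if and only if the coin matrix C is off-diagonal, i.e. a = d = 0. -/
open MeasureTheory Complex Filter

noncomputable section

namespace QWStmt0

/-- The Hilbert space `ℂ² ⊗ ℓ²(ℤ)`, realized as `ℓ²(({↑,↓}) × ℤ)`. -/
abbrev H : Type := lp (fun _ : Bool × ℤ => ℂ) 2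

/-- Basis vector `|σ⟩ ⊗ |n⟩`: `(true, n)` is `|↑⟩⊗|n⟩` and `(false, n)` is `|↓⟩⊗|n⟩`. -/
def e (p : Bool × ℤ) : H := lp.single 2 p 1

/-- `⟨X²⟩_Ψ(n) = ⟨Ψ, U^{-n} X² U^{n} Ψ⟩ = ⟨U^n Ψ, X² U^n Ψ⟩`, written spectrally. -/
def mom2 (U : H →L[ℂ] H) (Ψ : H) (n : ℕ) : ℝ :=
  ∑' p : Bool × ℤ, (p.2 : ℝ) ^ 2 * ‖(U ^ n) Ψ p‖ ^ 2

/-- `Ψ` belongs to the (maximal) domain of `X²`. -/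
def inDom2 (Ψ : H) : Prop := Summable (fun p : Bool × ℤ => (p.2 : ℝ) ^ 4 * ‖Ψ p‖ ^ 2)

lemma norm_sq_eq_tsum (f : H) : ‖f‖ ^ 2 = ∑' p, ‖f p‖ ^ 2 := by
  simpa using lp.norm_rpow_eq_tsum (p := 2) (by simp) f

lemma summable_norm_sq (f : H) : Summable fun p => ‖f p‖ ^ 2 := by
  simpa using (lp.memℓp f).summable (by simp)

lemma memℓp_two {f : Bool × ℤ → ℂ} (hf : Summable fun p => ‖f p‖ ^ 2) :
    Memℓp (E := fun _ : Bool × ℤ => ℂ) f 2 :=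
  memℓp_gen (by simpa using hf)

/-- The isometry that permutes coordinates and multiplies them by phases. -/
def phasePerm (π : Bool × ℤ ≃ Bool × ℤ) (s : Bool × ℤ → ℂ) (hs : ∀ p, ‖s p‖ = 1) :
    H →ₗᵢ[ℂ] H where
  toFun f := ⟨fun p => s p * f (π p), memℓp_two <| by
    simpa [hs, Function.comp_def] using π.summable_iff.2 (summable_norm_sq f)⟩
  map_add' f g := by
    ext p
    exact mul_add (s p) (f (π p)) (g (π p))
  map_smul' c f := by
    ext p
    exact mul_left_comm (s p) c (f (π p))
  norm_map' f := by
    rw [← sq_eq_sq₀ (norm_nonneg _) (norm_nonneg _), norm_sq_eq_tsum, norm_sq_eq_tsum]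
    simpa [hs] using π.tsum_eq fun p => ‖f p‖ ^ 2

lemma e_apply (p q : Bool × ℤ) : e p q = if q = p then 1 else 0 := by
  simp [e, lp.single_apply, Pi.single_apply]

/-- The coin observable `σ_z ⊗ I`. -/
def spin : H →L[ℂ] H :=
  (phasePerm (Equiv.refl _) (fun p => if p.1 then 1 else -1)
    (by rintro ⟨_ | _, _⟩ <;> simp)).toContinuousLinearMap

lemma spin_apply (f : H) (p : Bool × ℤ) : spin f p = (if p.1 then 1 else -1) * f p := rfl

lemma norm_spin_apply (f : H) : ‖spin f‖ = ‖f‖ := LinearIsometry.norm_map _ f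

/-- Translation of the lattice by `m` sites. -/
def translation (m : ℤ) : H →ₗᵢ[ℂ] H :=
  phasePerm ((Equiv.refl Bool).prodCongr (Equiv.subRight m)) (fun _ => 1) (by simp)

lemma translation_apply (m : ℤ) (f : H) (p : Bool × ℤ) :
    translation m f p = f (p.1, p.2 - m) := one_mul _

lemma translation_e (m : ℤ) (s : Bool) (n : ℤ) : translation m (e (s, n)) = e (s, n + m) := by
  ext ⟨t, k⟩
  simp [translation_apply, e_apply, sub_eq_iff_eq_add]

lemma spin_e_true (n : ℤ) : spin (e (true, n)) = e (true, n) := by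
  ext ⟨t, k⟩
  cases t <;> simp [spin_apply, e_apply]

lemma spin_e_false (n : ℤ) : spin (e (false, n)) = -e (false, n) := by
  ext ⟨t, k⟩
  cases t <;> simp [spin_apply, e_apply, neg_ite]

lemma spin_translation (m : ℤ) (f : H) : spin (translation m f) = translation m (spin f) := by
  ext p
  simp [spin_apply, translation_apply]

lemma smul_add_smul_apply (a b : ℂ) (f g : H) (p : Bool × ℤ) :
    (a • f + b • g) p = a * f p + b * g p := rfl

lemma hasSum_e (f : H) : HasSum (fun p => f p • e p) f := by
  convert! lp.hasSum_single (p := 2) (by simp) f using 2 with p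
  simp [e, ← lp.single_smul]

lemma ext_e {F : Type*} [NormedAddCommGroup F] [NormedSpace ℂ F] {A B : H →L[ℂ] F}
    (h : ∀ p, A (e p) = B (e p)) : A = B := by
  ext f
  have hA := (hasSum_e f).mapL A
  have hB := (hasSum_e f).mapL B
  simp only [map_smul, h] at hA hB
  exact hA.unique hB

/-- A uniformly bounded sequence of operators that converges on every basis vector
converges at every vector. -/
lemma exists_tendsto_of_e {A : ℕ → H →L[ℂ] H} {K : ℝ} (hK : ∀ n f, ‖A n f‖ ≤ K * ‖f‖)
    (h : ∀ p, ∃ y, Tendsto (fun n => A n (e p)) atTop (nhds y)) (f : H) :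
    ∃ y, Tendsto (fun n => A n f) atTop (nhds y) := by
  have hfin : ∀ s : Finset (Bool × ℤ),
      ∃ y, Tendsto (fun n => A n (∑ p ∈ s, f p • e p)) atTop (nhds y) := by
    intro s
    choose y hy using h
    refine ⟨∑ p ∈ s, f p • y p, ?_⟩
    simp only [map_sum, map_smul]
    exact tendsto_finsetSum _ fun p _ => (hy p).const_smul (f p)
  apply cauchySeq_tendsto_of_complete
  rw [Metric.cauchySeq_iff']
  intro ε hε
  have hK1 : 0 < |K| + 1 := by positivity
  have hδ : 0 < ε / (4 * (|K| + 1)) := by positivity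
  obtain ⟨s, hs⟩ := ((Metric.tendsto_nhds.1 (hasSum_e f)) _ hδ).exists
  obtain ⟨y, hy⟩ := hfin s
  obtain ⟨N, hN⟩ := Metric.cauchySeq_iff'.1 hy.cauchySeq (ε / 2) (by positivity)
  have hclose : ∀ n, dist (A n f) (A n (∑ p ∈ s, f p • e p)) < ε / 4 := by
    intro n
    rw [dist_eq_norm, ← map_sub]
    rw [dist_comm, dist_eq_norm] at hs
    have h1 := hK n (f - ∑ p ∈ s, f p • e p)
    have h2 : K * ‖f - ∑ p ∈ s, f p • e p‖ ≤ (|K| + 1) * ‖f - ∑ p ∈ s, f p • e p‖ :=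
      mul_le_mul_of_nonneg_right (by linarith [le_abs_self K]) (norm_nonneg _)
    have h3 := mul_lt_mul_of_pos_left hs hK1
    have h4 : (|K| + 1) * (ε / (4 * (|K| + 1))) = ε / 4 := by field_simp
    linarith
  refine ⟨N, fun n hn => ?_⟩
  have h1 := hclose n
  have h2 := hclose N
  have h3 := hN n hn
  rw [dist_comm] at h2
  have h4 := dist_triangle4 (A n f) (A n (∑ p ∈ s, f p • e p)) (A N (∑ p ∈ s, f p • e p)) (A N f)
  linarith

/-- `U = S (C ⊗ I)` is the coined walk with unitary coin `C`. -/
structure IsWalk (C : Matrix (Fin 2) (Fin 2) ℂ) (U : H →L[ℂ] H) : Prop where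
  coin : C ∈ Matrix.unitaryGroup (Fin 2) ℂ
  unitary : U ∈ unitary (H →L[ℂ] H)
  up : ∀ n : ℤ, U (e (true, n)) = C 0 0 • e (true, n + 1) + C 1 0 • e (false, n - 1)
  down : ∀ n : ℤ, U (e (false, n)) = C 0 1 • e (true, n + 1) + C 1 1 • e (false, n - 1)

lemma star_apply_apply {U : H →L[ℂ] H} (hU : U ∈ unitary (H →L[ℂ] H)) (f : H) :
    (star U) (U f) = f := by
  simpa using congr($(hU.1) f)

lemma apply_star_apply {U : H →L[ℂ] H} (hU : U ∈ unitary (H →L[ℂ] H)) (f : H) :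
    U ((star U) f) = f := by
  simpa using congr($(hU.2) f)

lemma norm_apply_of_unitary {U : H →L[ℂ] H} (hU : U ∈ unitary (H →L[ℂ] H)) (f : H) :
    ‖U f‖ = ‖f‖ :=
  ContinuousLinearMap.norm_map_of_mem_unitary hU f

lemma norm_star_apply {U : H →L[ℂ] H} (hU : U ∈ unitary (H →L[ℂ] H)) (f : H) :
    ‖(star U) f‖ = ‖f‖ :=
  norm_apply_of_unitary (Unitary.star_mem hU) f

/-- The Heisenberg evolution `U^{-j} (σ_z ⊗ I) U^j` of the coin observable. -/
def spinAt (U : H →L[ℂ] H) (j : ℕ) : H →L[ℂ] H := star U ^ j * spin * U ^ j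

lemma spinAt_zero (U : H →L[ℂ] H) (f : H) : spinAt U 0 f = spin f := by
  simp [spinAt]

lemma spinAt_succ (U : H →L[ℂ] H) (j : ℕ) (f : H) :
    spinAt U (j + 1) f = (star U) (spinAt U j (U f)) := by
  simp only [spinAt, pow_succ' (star U), pow_succ U, mul_apply_eq_comp]

lemma norm_spinAt_apply {U : H →L[ℂ] H} (hU : U ∈ unitary (H →L[ℂ] H)) (j : ℕ) (f : H) :
    ‖spinAt U j f‖ = ‖f‖ := by
  induction j generalizing f with
  | zero => rw [spinAt_zero, norm_spin_apply]
  | succ j ih => rw [spinAt_succ, norm_star_apply hU, ih, norm_apply_of_unitary hU]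

namespace IsWalk

variable {C : Matrix (Fin 2) (Fin 2) ℂ} {U : H →L[ℂ] H}

lemma apply_true (h : IsWalk C U) (f : H) (n : ℤ) :
    U f (true, n) = C 0 0 * f (true, n - 1) + C 0 1 * f (false, n - 1) := by
  let ev (p : Bool × ℤ) : H →L[ℂ] ℂ := lp.evalCLM ℂ (fun _ : Bool × ℤ => ℂ) 2 p
  have key : (ev (true, n)).comp U
      = C 0 0 • ev (true, n - 1) + C 0 1 • ev (false, n - 1) := by
    apply ext_e
    rintro ⟨_ | _, k⟩
    · change U (e (false, k)) (true, n) = C 0 0 * e _ _ + C 0 1 * e _ _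
      simp only [h.down, smul_add_smul_apply]
      simp [e_apply, sub_eq_iff_eq_add]
    · change U (e (true, k)) (true, n) = C 0 0 * e _ _ + C 0 1 * e _ _
      simp only [h.up, smul_add_smul_apply]
      simp [e_apply, sub_eq_iff_eq_add]
  exact congr($key f)

lemma apply_false (h : IsWalk C U) (f : H) (n : ℤ) :
    U f (false, n) = C 1 0 * f (true, n + 1) + C 1 1 * f (false, n + 1) := by
  let ev (p : Bool × ℤ) : H →L[ℂ] ℂ := lp.evalCLM ℂ (fun _ : Bool × ℤ => ℂ) 2 p
  have key : (ev (false, n)).comp U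
      = C 1 0 • ev (true, n + 1) + C 1 1 • ev (false, n + 1) := by
    apply ext_e
    rintro ⟨_ | _, k⟩
    · change U (e (false, k)) (false, n) = C 1 0 * e _ _ + C 1 1 * e _ _
      simp only [h.down, smul_add_smul_apply]
      simp [e_apply, eq_sub_iff_add_eq]
    · change U (e (true, k)) (false, n) = C 1 0 * e _ _ + C 1 1 * e _ _
      simp only [h.up, smul_add_smul_apply]
      simp [e_apply, eq_sub_iff_add_eq]
  exact congr($key f)

lemma apply_translation (h : IsWalk C U) (m : ℤ) (f : H) :
    U (translation m f) = translation m (U f) := by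
  ext ⟨_ | _, n⟩
  · simp only [h.apply_false, translation_apply, sub_add_eq_add_sub]
  · simp only [h.apply_true, translation_apply, sub_right_comm]

lemma star_translation (h : IsWalk C U) (m : ℤ) (f : H) :
    (star U) (translation m f) = translation m ((star U) f) := by
  conv_lhs => rw [← apply_star_apply h.unitary f]
  rw [← h.apply_translation, star_apply_apply h.unitary]

lemma spinAt_translation (h : IsWalk C U) (j : ℕ) (m : ℤ) (f : H) :
    spinAt U j (translation m f) = translation m (spinAt U j f) := by
  induction j generalizing f with
  | zero => simp only [spinAt_zero, spin_translation]
  | succ j ih => simp only [spinAt_succ, h.apply_translation, ih, h.star_translation]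

lemma norm_sq_coin (h : IsWalk C U) (x y : H) :
    ‖C 0 0 • x + C 1 0 • y‖ ^ 2 + ‖C 0 1 • x + C 1 1 • y‖ ^ 2 = ‖x‖ ^ 2 + ‖y‖ ^ 2 := by
  have hC := Matrix.mem_unitaryGroup_iff.1 h.coin
  have h00 := congr($hC 0 0)
  have h01 := congr($hC 0 1)
  have h10 := congr($hC 1 0)
  have h11 := congr($hC 1 1)
  simp only [Matrix.mul_apply, Fin.sum_univ_two, Matrix.star_apply, Matrix.one_apply_eq,
    RCLike.star_def] at h00 h01 h10 h11
  rw [Matrix.one_apply_ne (by decide)] at h01 h10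
  have key : ((‖C 0 0 • x + C 1 0 • y‖ ^ 2 + ‖C 0 1 • x + C 1 1 • y‖ ^ 2 : ℝ) : ℂ)
      = ((‖x‖ ^ 2 + ‖y‖ ^ 2 : ℝ) : ℂ) := by
    push_cast
    have hn : ∀ v : H, (‖v‖ : ℂ) ^ 2 = inner ℂ v v := fun v =>
      (inner_self_eq_norm_sq_to_K (𝕜 := ℂ) v).symm
    rw [hn, hn, hn, hn]
    simp only [inner_add_left, inner_add_right, inner_smul_left, inner_smul_right]
    linear_combination (inner ℂ x x) * h00 + (inner ℂ y x) * h01 + (inner ℂ x y) * h10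
      + (inner ℂ y y) * h11
  exact_mod_cast key

/-- A translation invariant operator `A` is recorded by the pair `(A |↑,0⟩, A |↓,0⟩)`;
this is the isometry induced on such pairs by `A ↦ U⁻¹ A U`. -/
def conj (h : IsWalk C U) : WithLp 2 (H × H) →ₗᵢ[ℂ] WithLp 2 (H × H) where
  toFun z := WithLp.toLp 2
    ((star U) (C 0 0 • translation 1 z.fst + C 1 0 • translation (-1) z.snd),
      (star U) (C 0 1 • translation 1 z.fst + C 1 1 • translation (-1) z.snd))
  map_add' y z := by
    apply WithLp.ofLp_injective
    simp only [WithLp.add_fst, WithLp.add_snd, map_add, smul_add, ← WithLp.toLp_add,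
      Prod.mk_add_mk]
    congr 1 <;> exact add_add_add_comm _ _ _ _
  map_smul' c z := by
    apply WithLp.ofLp_injective
    simp only [WithLp.smul_fst, WithLp.smul_snd, map_smul, ← WithLp.toLp_smul, Prod.smul_mk,
      RingHom.id_apply, smul_add, map_add, smul_comm c]
  norm_map' z := by
    rw [← sq_eq_sq₀ (norm_nonneg _) (norm_nonneg _), WithLp.prod_norm_sq_eq_of_L2,
      WithLp.prod_norm_sq_eq_of_L2]
    change ‖(star U) _‖ ^ 2 + ‖(star U) _‖ ^ 2 = _
    rw [norm_star_apply h.unitary, norm_star_apply h.unitary, h.norm_sq_coin,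
      LinearIsometry.norm_map, LinearIsometry.norm_map]

lemma conj_toLp (h : IsWalk C U) (A : H →L[ℂ] H)
    (hA : ∀ m f, A (translation m f) = translation m (A f)) :
    h.conj (WithLp.toLp 2 (A (e (true, 0)), A (e (false, 0))))
      = WithLp.toLp 2 ((star U) (A (U (e (true, 0)))), (star U) (A (U (e (false, 0))))) := by
  change WithLp.toLp 2
    ((star U) (C 0 0 • translation 1 (A _) + C 1 0 • translation (-1) (A _)),
      (star U) (C 0 1 • translation 1 (A _) + C 1 1 • translation (-1) (A _))) = _
  simp only [← hA, translation_e, h.up, h.down, map_add, map_smul, zero_add, zero_sub]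

lemma iterate_conj_spin (h : IsWalk C U) (j k : ℕ) :
    h.conj^[j] (WithLp.toLp 2 (spinAt U k (e (true, 0)), spinAt U k (e (false, 0))))
      = WithLp.toLp 2 (spinAt U (k + j) (e (true, 0)), spinAt U (k + j) (e (false, 0))) := by
  induction j with
  | zero => rfl
  | succ j ih =>
    rw [Function.iterate_succ_apply', ih, h.conj_toLp _ (h.spinAt_translation _)]
    simp only [← add_assoc, spinAt_succ]

/-- The time average of the coin observable. -/
def spinAvg (U : H →L[ℂ] H) (n : ℕ) : H →L[ℂ] H :=
  (n : ℂ)⁻¹ • ∑ j ∈ Finset.range n, spinAt U (j + 1)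

lemma spinAvg_apply (U : H →L[ℂ] H) (n : ℕ) (f : H) :
    spinAvg U n f = (n : ℂ)⁻¹ • ∑ j ∈ Finset.range n, spinAt U (j + 1) f := by
  simp [spinAvg]

lemma birkhoffAverage_conj (h : IsWalk C U) (n : ℕ) :
    birkhoffAverage ℂ h.conj _root_.id n
        (WithLp.toLp 2 (spinAt U 1 (e (true, 0)), spinAt U 1 (e (false, 0))))
      = WithLp.toLp 2 (spinAvg U n (e (true, 0)), spinAvg U n (e (false, 0))) := by
  simp only [birkhoffAverage, birkhoffSum, _root_.id, h.iterate_conj_spin, spinAvg_apply,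
    ← Prod.smul_mk, WithLp.toLp_smul, prod_mk_sum, WithLp.toLp_sum, add_comm 1]

lemma norm_spinAvg_apply_le (h : IsWalk C U) (n : ℕ) (f : H) : ‖spinAvg U n f‖ ≤ 1 * ‖f‖ := by
  rw [spinAvg_apply, norm_smul, norm_inv, Complex.norm_natCast, one_mul]
  have hsum : ‖∑ j ∈ Finset.range n, spinAt U (j + 1) f‖ ≤ n * ‖f‖ := by
    refine (norm_sum_le _ _).trans ?_
    simp [norm_spinAt_apply h.unitary]
  rcases n.eq_zero_or_pos with rfl | hn
  · simp
  · rw [inv_mul_le_iff₀ (by exact_mod_cast hn)]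
    exact hsum

lemma norm_conj_le (h : IsWalk C U) : ‖h.conj.toContinuousLinearMap‖ ≤ 1 :=
  h.conj.norm_toContinuousLinearMap_le

/-- The pair recording the operator `U ∘ translation (-1)`, which commutes with `U`. -/
def shiftedPair (U : H →L[ℂ] H) : WithLp 2 (H × H) :=
  WithLp.toLp 2 (U (translation (-1) (e (true, 0))), U (translation (-1) (e (false, 0))))

lemma conj_shiftedPair (h : IsWalk C U) : h.conj (shiftedPair U) = shiftedPair U := by
  have := h.conj_toLp (U.comp (translation (-1)).toContinuousLinearMap) (fun m f => by
    change U (translation (-1) (translation m f)) = translation m (U (translation (-1) f))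
    rw [h.apply_translation, h.apply_translation, h.apply_translation]
    ext p
    simp only [translation_apply, sub_right_comm])
  refine this.trans ?_
  change WithLp.toLp 2 ((star U) (U (translation (-1) (U _))),
    (star U) (U (translation (-1) (U _)))) = WithLp.toLp 2 (_, _)
  simp only [← h.apply_translation, star_apply_apply h.unitary]

lemma inner_shiftedPair_spin (h : IsWalk C U) :
    inner ℂ (shiftedPair U)
      (WithLp.toLp 2 (spinAt U 0 (e (true, 0)), spinAt U 0 (e (false, 0))))
      = starRingEnd ℂ (C 0 0) := by
  have he : ∀ (f : H) (p : Bool × ℤ), inner ℂ f (e p) = starRingEnd ℂ (f p) := by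
    intro f p
    simp [e, lp.inner_single_right]
  rw [WithLp.prod_inner_apply]
  change inner ℂ (U (translation (-1) (e (true, 0)))) (spinAt U 0 (e (true, 0)))
    + inner ℂ (U (translation (-1) (e (false, 0)))) (spinAt U 0 (e (false, 0))) = _
  rw [spinAt_zero, spinAt_zero, spin_e_true, spin_e_false, inner_neg_right, he, he,
    translation_e, translation_e, h.apply_true, h.apply_false]
  simp [e_apply]

lemma inner_shiftedPair_spin_one (h : IsWalk C U) :
    inner ℂ (shiftedPair U)
      (WithLp.toLp 2 (spinAt U 1 (e (true, 0)), spinAt U 1 (e (false, 0))))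
      = starRingEnd ℂ (C 0 0) := by
  have := h.iterate_conj_spin 1 0
  rw [Function.iterate_one, zero_add] at this
  rw [← this, ← h.conj_shiftedPair, h.conj.inner_map_map, h.inner_shiftedPair_spin]

lemma exists_tendsto_pair (h : IsWalk C U) :
    ∃ z : WithLp 2 (H × H),
      Tendsto (fun n => spinAvg U n (e (true, 0))) atTop (nhds z.fst) ∧
      Tendsto (fun n => spinAvg U n (e (false, 0))) atTop (nhds z.snd) ∧
      inner ℂ (shiftedPair U) z = starRingEnd ℂ (C 0 0) := by
  have hlim := h.conj.toContinuousLinearMap.tendsto_birkhoffAverage_orthogonalProjection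
    h.norm_conj_le (WithLp.toLp 2 (spinAt U 1 (e (true, 0)), spinAt U 1 (e (false, 0))))
  simp only [LinearIsometry.coe_toContinuousLinearMap, h.birkhoffAverage_conj] at hlim
  refine ⟨_, ((WithLp.continuous_fst 2 H H).tendsto _).comp hlim,
    ((WithLp.continuous_snd 2 H H).tendsto _).comp hlim, ?_⟩
  rw [← h.inner_shiftedPair_spin_one]
  exact Submodule.inner_orthogonalProjectionOnto_eq_of_mem_left
    (⟨shiftedPair U, h.conj_shiftedPair⟩ : h.conj.toContinuousLinearMap.eqLocus
      (1 : WithLp 2 (H × H) →L[ℂ] WithLp 2 (H × H))) _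

lemma spinAvg_translation (h : IsWalk C U) (n : ℕ) (m : ℤ) (f : H) :
    spinAvg U n (translation m f) = translation m (spinAvg U n f) := by
  simp only [spinAvg_apply, map_smul, map_sum, h.spinAt_translation]

lemma exists_tendsto_spinAvg (h : IsWalk C U) (f : H) :
    ∃ y, Tendsto (fun n => spinAvg U n f) atTop (nhds y) := by
  refine exists_tendsto_of_e h.norm_spinAvg_apply_le ?_ f
  obtain ⟨z, h1, h2, -⟩ := h.exists_tendsto_pair
  have htr : ∀ s m y, Tendsto (fun n => spinAvg U n (e (s, 0))) atTop (nhds y) →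
      ∃ y, Tendsto (fun n => spinAvg U n (e (s, m))) atTop (nhds y) := by
    intro s m y hy
    refine ⟨translation m y, ?_⟩
    have hm := ((translation m).continuous.tendsto y).comp hy
    simpa only [Function.comp_def, ← h.spinAvg_translation, translation_e, zero_add] using hm
  rintro ⟨_ | _, m⟩
  · exact htr _ m _ h2
  · exact htr _ m _ h1

/-- If `g = X f`, then `U^{-n} X U^n f` is `g` plus the sum of the evolved coin observables. -/
lemma position_pow (h : IsWalk C U) {f g : H} (hg : ∀ p, g p = p.2 * f p) (n : ℕ)
    (p : Bool × ℤ) :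
    (U ^ n) (g + ∑ j ∈ Finset.range n, spinAt U (j + 1) f) p = p.2 * (U ^ n) f p := by
  induction n generalizing p with
  | zero => simpa using hg p
  | succ n ih =>
    have hcancel : ∀ k (v : H), (U ^ k) ((star U ^ k) v) = v := by
      intro k v
      induction k generalizing v with
      | zero => rfl
      | succ k ihk =>
        rw [pow_succ U, pow_succ' (star U), mul_apply_eq_comp, mul_apply_eq_comp,
          apply_star_apply h.unitary, ihk]
    have hspin : (U ^ (n + 1)) (spinAt U (n + 1) f) = spin (U ((U ^ n) f)) := by
      rw [spinAt, mul_apply_eq_comp, mul_apply_eq_comp, hcancel, pow_succ' U, mul_apply_eq_comp]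
    rw [Finset.sum_range_succ, ← add_assoc, map_add, hspin, pow_succ' U, mul_apply_eq_comp,
      mul_apply_eq_comp]
    set v := (U ^ n) f
    set w := (U ^ n) (g + ∑ j ∈ Finset.range n, spinAt U (j + 1) f)
    change U w p + spin (U v) p = p.2 * U v p
    obtain ⟨_ | _, k⟩ := p
    · simp only [spin_apply, h.apply_false, ih]
      push_cast
      simp
      ring
    · simp only [spin_apply, h.apply_true, ih]
      push_cast
      simp
      ring

lemma norm_pow_apply (h : IsWalk C U) (n : ℕ) (f : H) : ‖(U ^ n) f‖ = ‖f‖ :=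
  norm_apply_of_unitary (pow_mem h.unitary n) f

lemma mom2_div_eq (h : IsWalk C U) {f g : H} (hg : ∀ p, g p = p.2 * f p) (n : ℕ) :
    mom2 U f n / (n : ℝ) ^ 2 = ‖(n : ℂ)⁻¹ • g + spinAvg U n f‖ ^ 2 := by
  have hmom : mom2 U f n = ‖g + ∑ j ∈ Finset.range n, spinAt U (j + 1) f‖ ^ 2 := by
    rw [← h.norm_pow_apply n, norm_sq_eq_tsum]
    refine tsum_congr fun p => ?_
    rw [h.position_pow hg, norm_mul, mul_pow]
    simp
  rw [hmom, spinAvg_apply, ← smul_add, norm_smul, mul_pow, norm_inv, Complex.norm_natCast,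
    inv_pow, div_eq_inv_mul]

lemma tendsto_mom2 (h : IsWalk C U) {f g y : H} (hg : ∀ p, g p = p.2 * f p)
    (hy : Tendsto (fun n => spinAvg U n f) atTop (nhds y)) :
    Tendsto (fun n : ℕ => mom2 U f n / (n : ℝ) ^ 2) atTop (nhds (‖y‖ ^ 2)) := by
  simp only [h.mom2_div_eq hg]
  have h0 : Tendsto (fun n : ℕ => (n : ℂ)⁻¹ • g) atTop (nhds 0) := by
    simpa using (tendsto_inv_atTop_nhds_zero_nat (𝕜 := ℂ)).smul_const g
  simpa using ((h0.add hy).norm).pow 2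

lemma tendsto_spinAvg_zero (h : IsWalk C U) (h00 : C 0 0 = 0) (h11 : C 1 1 = 0) (f : H) :
    Tendsto (fun n => spinAvg U n f) atTop (nhds 0) := by
  have hanti : ∀ v, spin (U v) = -U (spin v) := by
    intro v
    ext ⟨_ | _, k⟩
    · change spin (U v) _ = -(U (spin v) _)
      simp [spin_apply, h.apply_false, h11]
    · change spin (U v) _ = -(U (spin v) _)
      simp [spin_apply, h.apply_true, h00]
  have hsign : ∀ j v, spinAt U j v = (-1 : ℂ) ^ j • spin v := by
    intro j
    induction j with
    | zero => simp [spinAt_zero]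
    | succ j ih =>
      intro v
      rw [spinAt_succ, ih, hanti, map_smul, map_neg, star_apply_apply h.unitary, pow_succ]
      simp
  have hbound : ∀ n, ‖spinAvg U n f‖ ≤ (n : ℝ)⁻¹ * ‖f‖ := by
    intro n
    have hs : ‖∑ j ∈ Finset.range n, (-1 : ℂ) ^ (j + 1)‖ ≤ 1 := by
      simp only [pow_succ, ← Finset.sum_mul, neg_one_geom_sum]
      split_ifs <;> simp
    rw [spinAvg_apply, norm_smul, norm_inv, Complex.norm_natCast]
    simp only [hsign, ← Finset.sum_smul, norm_smul, norm_spin_apply]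
    gcongr
    exact mul_le_of_le_one_left (norm_nonneg _) hs
  refine squeeze_zero_norm hbound ?_
  simpa using (tendsto_inv_atTop_nhds_zero_nat (𝕜 := ℝ)).mul_const ‖f‖

lemma norm_diag_eq (h : IsWalk C U) : ‖C 0 0‖ = ‖C 1 1‖ := by
  have h1 := congr($(Matrix.mem_unitaryGroup_iff.1 h.coin) 0 0)
  have h2 := congr($(Matrix.mem_unitaryGroup_iff'.1 h.coin) 1 1)
  simp only [Matrix.mul_apply, Fin.sum_univ_two, Matrix.star_apply, Matrix.one_apply_eq,
    RCLike.star_def, Complex.mul_conj', Complex.conj_mul'] at h1 h2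
  have h3 : ‖C 0 0‖ ^ 2 = ‖C 1 1‖ ^ 2 := by
    have : (‖C 0 0‖ : ℂ) ^ 2 = (‖C 1 1‖ : ℂ) ^ 2 := by linear_combination h1 - h2
    exact_mod_cast this
  exact (sq_eq_sq₀ (norm_nonneg _) (norm_nonneg _)).1 h3

end IsWalk

lemma inDom2.exists_position {f : H} (hf : inDom2 f) : ∃ g : H, ∀ p, g p = p.2 * f p := by
  refine ⟨⟨fun p => p.2 * f p, memℓp_two ?_⟩, fun _ => rfl⟩
  refine Summable.of_nonneg_of_le (fun p => by positivity) (fun p => ?_) hf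
  rw [norm_mul, mul_pow, Complex.norm_intCast, sq_abs]
  refine mul_le_mul_of_nonneg_right ?_ (by positivity)
  have hsq : p.2 ^ 2 ≤ p.2 ^ 4 := by
    rcases eq_or_ne p.2 0 with h0 | h0
    · simp [h0]
    · have : 0 < p.2 ^ 2 := by positivity
      nlinarith
  exact_mod_cast hsq

lemma inDom2_e (p : Bool × ℤ) : inDom2 (e p) := by
  refine summable_of_ne_finset_zero (s := {p}) fun q hq => ?_
  rw [Finset.mem_singleton] at hq
  simp [e_apply, hq]

/-- Lemma 2.1 (Deterministic walk): for `U = S (C ⊗ 1)` with a fixed unitary coin `C`,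
the limit `B = lim ⟨X²⟩_Ψ(n)/n²` exists and is nonnegative for every `Ψ` in the domain
of `X²`, and `B = 0` for all such `Ψ` iff the coin `C` is off-diagonal, `a = d = 0`. -/
theorem deterministic_walk_ballistic
    (C : Matrix (Fin 2) (Fin 2) ℂ) (hC : C ∈ Matrix.unitaryGroup (Fin 2) ℂ)
    (U : H →L[ℂ] H) (hUunitary : U ∈ unitary (H →L[ℂ] H))
    (hUup : ∀ n : ℤ, U (e (true, n)) = C 0 0 • e (true, n + 1) + C 1 0 • e (false, n - 1))
    (hUdown : ∀ n : ℤ, U (e (false, n)) = C 0 1 • e (true, n + 1) + C 1 1 • e (false, n - 1)) :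
    (∀ Ψ : H, inDom2 Ψ →
      ∃ B : ℝ, 0 ≤ B ∧ Tendsto (fun n : ℕ => mom2 U Ψ n / (n : ℝ) ^ 2) atTop (nhds B)) ∧
    ((∀ Ψ : H, inDom2 Ψ →
        Tendsto (fun n : ℕ => mom2 U Ψ n / (n : ℝ) ^ 2) atTop (nhds 0))
      ↔ (C 0 0 = 0 ∧ C 1 1 = 0)) := by
  have h : IsWalk C U := ⟨hC, hUunitary, hUup, hUdown⟩
  refine ⟨fun Ψ hΨ => ?_, fun hzero => ?_, fun ⟨h00, h11⟩ Ψ hΨ => ?_⟩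
  · obtain ⟨g, hg⟩ := hΨ.exists_position
    obtain ⟨y, hy⟩ := h.exists_tendsto_spinAvg Ψ
    exact ⟨‖y‖ ^ 2, by positivity, h.tendsto_mom2 hg hy⟩
  · have hlim : ∀ p y, Tendsto (fun n => IsWalk.spinAvg U n (e p)) atTop (nhds y) → y = 0 := by
      intro p y hy
      obtain ⟨g, hg⟩ := (inDom2_e p).exists_position
      simpa using tendsto_nhds_unique (h.tendsto_mom2 hg hy) (hzero _ (inDom2_e p))
    obtain ⟨z, h1, h2, hz⟩ := h.exists_tendsto_pair
    rw [WithLp.prod_inner_apply] at hz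
    have h00 : C 0 0 = 0 := by
      refine (map_eq_zero (starRingEnd ℂ)).1 (hz.symm.trans ?_)
      change inner ℂ (IsWalk.shiftedPair U).fst z.fst + inner ℂ (IsWalk.shiftedPair U).snd z.snd = 0
      rw [hlim _ _ h1, hlim _ _ h2, inner_zero_right, inner_zero_right, add_zero]
    exact ⟨h00, norm_eq_zero.1 (by rw [← h.norm_diag_eq, h00, norm_zero])⟩
  · obtain ⟨g, hg⟩ := hΨ.exists_position
    simpa using h.tendsto_mom2 hg (h.tendsto_spinAvg_zero h00 h11 Ψ)

end QWStmt0
end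
end

section
/- For every phase configuration ω ∈ 𝕋^ℤ there exists a diagonal unitary operator V on ℓ²(ℤ), V e_n = e^{i ζ_n} e_n with ζ_n ∈ 𝕋, such that V^{-1} Ũ_ω V = Ũ_0, where Ũ_0 is the operator with all phases equal to zero. In particular, the randomness in Konno's model of a quantum walk in a random environment can be completely gauged away, and Ũ_ω is unitarily equivalent to a deterministic operator. -/
open MeasureTheory Complex Filter

noncomputable section

namespace QWStmt2

instance : Fact (0 < 2 * Real.pi) := ⟨by positivity⟩

/-- The circle `𝕋 = ℝ/2πℤ`. -/
abbrev 𝕋 : Type := AddCircle (2 * Real.pi)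

lemma phase_periodic : Function.Periodic (fun θ : ℝ => Complex.exp (Complex.I * θ)) (2 * Real.pi) := by
  intro x
  simp only [Complex.ofReal_add]
  rw [mul_add, Complex.exp_add,
    show Complex.I * ((2 * Real.pi : ℝ) : ℂ) = 2 * (Real.pi : ℂ) * Complex.I by push_cast; ring,
    Complex.exp_two_pi_mul_I, mul_one]

/-- `ph θ = e^{iθ}` for `θ ∈ 𝕋 = ℝ/2πℤ`. -/
def ph : 𝕋 → ℂ := phase_periodic.lift

/-- `ℓ²(ℤ)`. -/
abbrev ℓ2 : Type := lp (fun _ : ℤ => ℂ) 2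

/-- The canonical basis of `ℓ²(ℤ)`. -/
def e (n : ℤ) : ℓ2 := lp.single 2 n 1

/-- Multiplication of a square-summable sequence by a unimodular sequence. -/
def diagonalEquiv (c : ℤ → ℂ) (hc : ∀ n, ‖c n‖ = 1) : ℓ2 ≃ₗᵢ[ℂ] ℓ2 where
  toFun f := ⟨fun n => c n * f n, (lp.memℓp f).mono' fun n => by simp [hc]⟩
  invFun f := ⟨fun n => (c n)⁻¹ * f n, (lp.memℓp f).mono' fun n => by simp [hc]⟩
  map_add' f g := by ext n; exact mul_add _ _ _
  map_smul' a f := by ext n; exact mul_left_comm _ _ _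
  left_inv f := by
    ext n
    exact inv_mul_cancel_left₀ (norm_ne_zero_iff.mp (by simp [hc])) _
  right_inv f := by
    ext n
    exact mul_inv_cancel_left₀ (norm_ne_zero_iff.mp (by simp [hc])) _
  norm_map' f := le_antisymm
    (lp.norm_mono two_ne_zero fun n => (by simp [hc] : ‖c n * f n‖ ≤ ‖f n‖))
    (lp.norm_mono two_ne_zero fun n => (by simp [hc] : ‖f n‖ ≤ ‖c n * f n‖))

lemma diagonalEquiv_e (c : ℤ → ℂ) (hc : ∀ n, ‖c n‖ = 1) (n : ℤ) :
    diagonalEquiv c hc (e n) = c n • e n := by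
  ext m
  change c m * (e n : ℤ → ℂ) m = c n * (e n : ℤ → ℂ) m
  rcases eq_or_ne m n with rfl | hmn
  · rfl
  · simp [e, hmn]

lemma continuousLinearMap_ext_e {A B : ℓ2 →L[ℂ] ℓ2} (h : ∀ n, A (e n) = B (e n)) : A = B := by
  refine lp.ext_continuousLinearMap ENNReal.ofNat_ne_top fun n => ?_
  ext1
  exact h n

lemma ph_coe (x : ℝ) : ph (x : 𝕋) = Complex.exp (Complex.I * x) := rfl

lemma exists_int_antidifference (w : ℤ → ℝ) : ∃ S : ℤ → ℝ, ∀ k, S (k + 1) = S k + w k := by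
  refine ⟨fun k => ∑ i ∈ Finset.Ico 0 k, w i - ∑ i ∈ Finset.Ico k 0, w i, fun k => ?_⟩
  rcases le_or_gt 0 k with hk | hk
  · have h : Finset.Ico 0 (k + 1) = insert k (Finset.Ico 0 k) := by ext; simp; omega
    simp [h, Finset.Ico_eq_empty_of_le hk, Finset.Ico_eq_empty_of_le (by omega : (0 : ℤ) ≤ k + 1)]
    ring
  · have h : Finset.Ico k 0 = insert k (Finset.Ico (k + 1) 0) := by ext; simp; omega
    simp [h, Finset.Ico_eq_empty_of_le hk.le, Finset.Ico_eq_empty_of_le (by omega : k + 1 ≤ 0)]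

/-- In Konno's model the randomness can be gauged away completely: there is a diagonal
unitary `V`, `V e_n = e^{iζ_n} e_n`, with `V⁻¹ Ũ_ω V = Ũ_0`, the operator with all
phases set to zero. -/
theorem konno_randomness_gauged_away
    (r t : ℝ) (hr0 : 0 < r) (hr1 : r < 1) (ht0 : 0 < t) (ht1 : t < 1) (hrt : r ^ 2 + t ^ 2 = 1)
    (ω : ℤ → 𝕋)
    (Uω U0 : ℓ2 →L[ℂ] ℓ2)
    (hUω : ∀ k : ℤ,
      Uω (e (2 * k)) = (r : ℂ) • e (2 * k - 1) + ((t : ℂ) * ph (-ω (2 * k))) • e (2 * k + 2) ∧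
      Uω (e (2 * k + 1)) = -((t : ℂ) * ph (ω (2 * k))) • e (2 * k - 1) + (r : ℂ) • e (2 * k + 2))
    (hU0 : ∀ k : ℤ,
      U0 (e (2 * k)) = (r : ℂ) • e (2 * k - 1) + (t : ℂ) • e (2 * k + 2) ∧
      U0 (e (2 * k + 1)) = -(t : ℂ) • e (2 * k - 1) + (r : ℂ) • e (2 * k + 2)) :
    ∃ V : ℓ2 →L[ℂ] ℓ2, V ∈ unitary (ℓ2 →L[ℂ] ℓ2) ∧
      (∃ ζ : ℤ → ℝ, ∀ n : ℤ, V (e n) = Complex.exp (Complex.I * ζ n) • e n) ∧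
      star V * Uω * V = U0 := by
  choose w hw using fun k : ℤ => QuotientAddGroup.mk_surjective (ω (2 * k))
  obtain ⟨S, hS⟩ := exists_int_antidifference fun k => -w k
  have hph (k : ℤ) : ph (ω (2 * k)) = Complex.exp (Complex.I * w k) := by
    rw [← hw k]; exact ph_coe _
  have hph' (k : ℤ) : ph (-ω (2 * k)) = Complex.exp (Complex.I * (-w k : ℝ)) := by
    rw [← hw k]; exact ph_coe _
  let ζ : ℤ → ℝ := fun n => S ((n + 1) / 2)
  have hζ_even (k : ℤ) : ζ (2 * k) = S k := congrArg S (by omega)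
  have hζ_pred (k : ℤ) : ζ (2 * k - 1) = S k := congrArg S (by omega)
  have hζ_odd (k : ℤ) : ζ (2 * k + 1) = S k + -w k :=
    (congrArg S (by omega)).trans (hS k)
  have hζ_next (k : ℤ) : ζ (2 * k + 2) = S k + -w k :=
    (congrArg S (by omega)).trans (hS k)
  let c : ℤ → ℂ := fun n => Complex.exp (Complex.I * ζ n)
  have hc (n : ℤ) : ‖c n‖ = 1 := by
    simpa only [c, mul_comm] using Complex.norm_exp_ofReal_mul_I (ζ n)
  let u := Unitary.linearIsometryEquiv.symm (diagonalEquiv c hc)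
  let V : ℓ2 →L[ℂ] ℓ2 := u
  have hV (n : ℤ) : V (e n) = Complex.exp (Complex.I * ζ n) • e n := diagonalEquiv_e c hc n
  refine ⟨V, u.2, ⟨ζ, hV⟩, ?_⟩
  have key : Uω * V = V * U0 := by
    refine continuousLinearMap_ext_e fun n => ?_
    have hexp (k : ℤ) : Complex.exp (Complex.I * w k) * Complex.exp (-(Complex.I * w k)) = 1 := by
      rw [← Complex.exp_add, add_neg_cancel, Complex.exp_zero]
    rcases Int.even_or_odd' n with ⟨k, rfl | rfl⟩
    · simp only [mul_apply_eq_comp, hV, map_smul, map_add, (hUω k).1, (hU0 k).1,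
        hζ_even, hζ_pred, hζ_next, hph', Complex.ofReal_add, mul_add, Complex.exp_add]
      module
    · simp only [mul_apply_eq_comp, hV, map_smul, map_add, (hUω k).2, (hU0 k).2,
        hζ_odd, hζ_pred, hζ_next, hph, Complex.ofReal_add, Complex.ofReal_neg, mul_add, mul_neg,
        Complex.exp_add, smul_add, smul_smul]
      congr 2
      · linear_combination (-(t : ℂ) * Complex.exp (Complex.I * S k)) * hexp k
      · ring
  rw [mul_assoc, key, ← mul_assoc, Unitary.star_mul_self_of_mem u.2, one_mul]

end QWStmt2
end
end

section
/- For every integer n ≥ 1 and every y ∈ ℂ, lim_{τ→∞, τ∈ℕ} Σ_{k=−τn}^{τn} e^{i y k / sqrt(τ)} w_k(τ n) = e^{−n (t²/(2r²)) y²}, and the convergence is uniform for y in any compact subset of ℂ. -/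
open MeasureTheory Complex Filter

noncomputable section

namespace QWStmt16

/-- sign of a step: `true ↦ +1`, `false ↦ -1`. -/
def sgn (b : Bool) : ℤ := if b then 1 else -1

/-- Path probability of the persistent random walk with initial probability `a` of
stepping right, persistence probability `t²` and flip probability `r²`. -/
def prw (a r t : ℝ) {n : ℕ} (σ : Fin n → Bool) : ℝ :=
  ∏ j : Fin n,
    if (j : ℕ) = 0 then (if σ j then a else 1 - a)
    else (if σ j = σ ⟨(j : ℕ) - 1, lt_of_le_of_lt (Nat.sub_le _ _) j.isLt⟩
          then t ^ 2 else r ^ 2)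

/-- `w k n = P(S_n = k)`, the distribution of the persistent random walk. -/
def w (a r t : ℝ) (n : ℕ) (k : ℤ) : ℝ :=
  ∑ σ : Fin n → Bool, if (∑ j : Fin n, sgn (σ j)) = k then prw a r t σ else 0

/-- The exponential generating function of the walk after `m + 1` steps, restricted to the paths
whose last step is `b`. -/
def endGF (a r t : ℝ) (z : ℂ) (b : Bool) (m : ℕ) : ℂ :=
  ∑ σ : Fin (m + 1) → Bool,
    if σ (Fin.last m) = b then (prw a r t σ : ℂ) * exp (z * (∑ j, sgn (σ j) : ℤ)) else 0

lemma prw_snoc (a r t : ℝ) {m : ℕ} (σ : Fin (m + 1) → Bool) (b : Bool) :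
    prw a r t (Fin.snoc (α := fun _ => Bool) σ b : Fin (m + 2) → Bool) =
      prw a r t σ * if b = σ (Fin.last m) then t ^ 2 else r ^ 2 := by
  have castSucc_eq (j : ℕ) (hj : j < m + 1) (hj' : j < m + 2) :
      (Fin.snoc (α := fun _ => Bool) σ b : Fin (m + 2) → Bool) ⟨j, hj'⟩ = σ ⟨j, hj⟩ :=
    Fin.snoc_castSucc (α := fun _ => Bool) b σ ⟨j, hj⟩
  unfold prw
  rw [Fin.prod_univ_castSucc]
  congr 1
  · refine Finset.prod_congr rfl fun j _ => ?_
    rw [Fin.snoc_castSucc, castSucc_eq _ (by omega)]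
    rfl
  · rw [Fin.snoc_last, castSucc_eq _ (by simp)]
    simp [Fin.last]

lemma sum_sgn_snoc {m : ℕ} (σ : Fin m → Bool) (b : Bool) :
    ∑ j, sgn ((Fin.snoc (α := fun _ => Bool) σ b : Fin (m + 1) → Bool) j) =
      ∑ j, sgn (σ j) + sgn b := by
  simp [Fin.sum_univ_castSucc]

lemma endGF_succ (a r t : ℝ) (z : ℂ) (b : Bool) (m : ℕ) :
    endGF a r t z b (m + 1) =
      exp (z * sgn b) * ((t : ℂ) ^ 2 * endGF a r t z b m + (r : ℂ) ^ 2 * endGF a r t z (!b) m) := by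
  unfold endGF
  rw [← (Fin.snocEquiv fun _ => Bool).sum_comp, Fintype.sum_prod_type, Finset.sum_eq_single b,
    Finset.mul_sum, Finset.mul_sum, ← Finset.sum_add_distrib, Finset.mul_sum]
  · refine Finset.sum_congr rfl fun σ _ => ?_
    simp only [Fin.snocEquiv, Equiv.coe_fn_mk, Fin.snoc_last, if_true]
    rw [prw_snoc, sum_sgn_snoc]
    rw [Int.cast_add, mul_add, exp_add]
    cases b <;> cases h : σ (Fin.last m) <;> simp <;> ring
  · intro c _ hc
    refine Finset.sum_eq_zero fun σ _ => ?_
    simp [Fin.snocEquiv, hc]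
  · simp

lemma endGF_zero (a r t : ℝ) (z : ℂ) (b : Bool) :
    endGF a r t z b 0 = (if b then (a : ℂ) else 1 - a) * exp (z * sgn b) := by
  unfold endGF
  rw [← (Equiv.funUnique (Fin 1) Bool).symm.sum_comp, Fintype.sum_bool]
  cases b <;> simp [prw]

lemma sum_sgn_mem_Icc {m : ℕ} (σ : Fin m → Bool) :
    ∑ j, sgn (σ j) ∈ Finset.Icc (-(m : ℤ)) m := by
  have h : |∑ j, sgn (σ j)| ≤ m := by
    refine (Finset.abs_sum_le_sum_abs _ _).trans ?_
    refine (Finset.sum_le_card_nsmul _ _ 1 fun j _ => ?_).trans (by simp)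
    cases σ j <;> simp [sgn]
  exact Finset.mem_Icc.2 (abs_le.1 h)

lemma sum_exp_mul_w (a r t : ℝ) (z : ℂ) (m : ℕ) :
    ∑ k ∈ Finset.Icc (-(m : ℤ)) m, exp (z * k) * (w a r t m k : ℂ) =
      ∑ σ : Fin m → Bool, (prw a r t σ : ℂ) * exp (z * (∑ j, sgn (σ j) : ℤ)) := by
  simp only [w, ofReal_sum, Finset.mul_sum]
  rw [Finset.sum_comm]
  refine Finset.sum_congr rfl fun σ _ => ?_
  rw [Finset.sum_eq_single (∑ j, sgn (σ j))]
  · simp [mul_comm]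
  · intro k _ hk
    simp [hk.symm]
  · exact fun h => absurd (sum_sgn_mem_Icc σ) h

/-- The exponential generating function of the walk after `m + 1` steps. -/
def walkGF (a r t : ℝ) (z : ℂ) (m : ℕ) : ℂ :=
  endGF a r t z true m + endGF a r t z false m

lemma sum_exp_mul_w_succ (a r t : ℝ) (z : ℂ) (m : ℕ) :
    ∑ k ∈ Finset.Icc (-((m + 1 : ℕ) : ℤ)) (m + 1 : ℕ), exp (z * k) * (w a r t (m + 1) k : ℂ) =
      walkGF a r t z m := by
  rw [sum_exp_mul_w, walkGF, endGF, endGF, ← Finset.sum_add_distrib]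
  refine Finset.sum_congr rfl fun σ _ => ?_
  cases σ (Fin.last m) <;> simp

lemma walkGF_zero (a r t : ℝ) (z : ℂ) :
    walkGF a r t z 0 = a * exp z + (1 - a) * exp (-z) := by
  simp [walkGF, endGF_zero, sgn]

lemma walkGF_one (a r t : ℝ) (z : ℂ) :
    walkGF a r t z 1 =
      exp z * ((t : ℂ) ^ 2 * (a * exp z) + (r : ℂ) ^ 2 * ((1 - a) * exp (-z))) +
      exp (-z) * ((t : ℂ) ^ 2 * ((1 - a) * exp (-z)) + (r : ℂ) ^ 2 * (a * exp z)) := by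
  simp [walkGF, endGF_zero, endGF_succ, sgn]

lemma walkGF_add_two (a : ℝ) {r t : ℝ} (hrt : r ^ 2 + t ^ 2 = 1) (z : ℂ) (m : ℕ) :
    walkGF a r t z (m + 2) =
      2 * (t : ℂ) ^ 2 * cosh z * walkGF a r t z (m + 1) -
        ((t : ℂ) ^ 2 - (r : ℂ) ^ 2) * walkGF a r t z m := by
  have hz : exp z * exp (-z) = 1 := by rw [← exp_add]; simp
  have hrt' : (r : ℂ) ^ 2 + (t : ℂ) ^ 2 = 1 := mod_cast hrt
  simp only [walkGF, endGF_succ, sgn, cosh]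
  simp only [if_true, Bool.not_true, Bool.not_false, Bool.false_eq_true, if_false, Int.cast_one,
    Int.cast_neg, mul_one, mul_neg]
  generalize endGF a r t z true m = P
  generalize endGF a r t z false m = Q
  generalize exp z = x at *
  generalize exp (-z) = u at *
  have hr : (r : ℂ) ^ 2 = 1 - (t : ℂ) ^ 2 := by rw [← hrt']; ring
  rw [hr]
  generalize (t : ℂ) ^ 2 = T
  linear_combination (P + Q) * (1 - 2 * T) * hz

/-- Closed form of a second order linear recurrence with characteristic roots `p` and `q`. -/
lemma binet_of_recurrence {R : Type*} [CommRing R] {p q : R} {F : ℕ → R}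
    (hF : ∀ m, F (m + 2) = (p + q) * F (m + 1) - p * q * F m) (m : ℕ) :
    (p - q) * F m = (F 1 - q * F 0) * p ^ m - (F 1 - p * F 0) * q ^ m := by
  induction m using Nat.twoStepInduction with
  | zero => ring
  | one => ring
  | more m h₀ h₁ =>
    rw [hF]
    linear_combination (p + q) * h₁ - p * q * h₀

/-- First order asymptotics of a function vanishing at a point, along a rescaled filter. -/
lemma tendsto_mul_comp_of_hasDerivAt {α : Type*} {l : Filter α} {f : ℂ → ℂ} {f' x L : ℂ}
    (hf : HasDerivAt f f' x) (hfx : f x = 0) {u s : α → ℂ} (hu : Tendsto u l (nhds x))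
    (hsu : Tendsto (fun i => s i * (u i - x)) l (nhds L)) :
    Tendsto (fun i => s i * f (u i)) l (nhds (f' * L)) := by
  have hd : ContinuousAt (dslope f x) x := continuousAt_dslope_same.2 hf.differentiableAt
  have h := (hd.tendsto.comp hu).mul hsu
  rw [dslope_same, hf.deriv] at h
  refine h.congr fun i => ?_
  have := sub_smul_dslope f x (u i)
  rw [hfx, sub_zero, smul_eq_mul] at this
  rw [← this, Function.comp_apply]
  ring

/-- Square root of the discriminant of the characteristic polynomial
`X ^ 2 - 2 t² c X + (t² - r²)`. -/
def discSqrt (r t : ℝ) (c : ℂ) : ℂ :=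
  ((t : ℂ) ^ 4 * c ^ 2 - ((t : ℂ) ^ 2 - (r : ℂ) ^ 2)) ^ (1 / 2 : ℂ)

lemma discSqrt_sq (r t : ℝ) (c : ℂ) :
    discSqrt r t c ^ 2 = (t : ℂ) ^ 4 * c ^ 2 - ((t : ℂ) ^ 2 - (r : ℂ) ^ 2) := by
  have := cpow_nat_inv_pow ((t : ℂ) ^ 4 * c ^ 2 - ((t : ℂ) ^ 2 - (r : ℂ) ^ 2)) two_ne_zero
  simpa only [discSqrt, one_div, Nat.cast_ofNat] using this

lemma disc_one {r t : ℝ} (hrt : r ^ 2 + t ^ 2 = 1) :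
    (t : ℂ) ^ 4 * 1 ^ 2 - ((t : ℂ) ^ 2 - (r : ℂ) ^ 2) = ((r ^ 4 : ℝ) : ℂ) := by
  have hrt' : (r : ℂ) ^ 2 = 1 - (t : ℂ) ^ 2 := by
    rw [eq_sub_iff_add_eq]; exact_mod_cast hrt
  push_cast
  rw [show (r : ℂ) ^ 4 = ((r : ℂ) ^ 2) ^ 2 by ring, hrt']
  ring

lemma discSqrt_one {r t : ℝ} (hrt : r ^ 2 + t ^ 2 = 1) : discSqrt r t 1 = (r : ℂ) ^ 2 := by
  rw [discSqrt, disc_one hrt, show (1 / 2 : ℂ) = ((1 / 2 : ℝ) : ℂ) by norm_num,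
    ← ofReal_cpow (by positivity), ← Real.sqrt_eq_rpow,
    show r ^ 4 = (r ^ 2) ^ 2 by ring, Real.sqrt_sq (by positivity)]
  norm_num

lemma hasDerivAt_discSqrt {r t : ℝ} (hr : r ≠ 0) (hrt : r ^ 2 + t ^ 2 = 1) :
    HasDerivAt (discSqrt r t) ((t : ℂ) ^ 4 / (r : ℂ) ^ 2) 1 := by
  have hr' : (r : ℂ) ≠ 0 := by exact_mod_cast hr
  have hD : HasDerivAt (fun c : ℂ => (t : ℂ) ^ 4 * c ^ 2 - ((t : ℂ) ^ 2 - (r : ℂ) ^ 2))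
      ((t : ℂ) ^ 4 * 2) 1 := by
    simpa using (((hasDerivAt_id (1 : ℂ)).pow 2).const_mul ((t : ℂ) ^ 4)).sub_const
      ((t : ℂ) ^ 2 - (r : ℂ) ^ 2)
  have hmem : (t : ℂ) ^ 4 * 1 ^ 2 - ((t : ℂ) ^ 2 - (r : ℂ) ^ 2) ∈ slitPlane := by
    rw [disc_one hrt, ofReal_mem_slitPlane]
    positivity
  have hdiff : DifferentiableAt ℂ (discSqrt r t) 1 :=
    (HasDerivAt.cpow_const (c := (1 / 2 : ℂ)) hD hmem).differentiableAt
  have h := hdiff.hasDerivAt.pow 2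
  have heq : discSqrt r t ^ 2 = fun c : ℂ => (t : ℂ) ^ 4 * c ^ 2 - ((t : ℂ) ^ 2 - (r : ℂ) ^ 2) :=
    funext fun c => discSqrt_sq r t c
  rw [heq] at h
  have key := h.unique hD
  rw [discSqrt_one hrt] at key
  have hderiv : deriv (discSqrt r t) 1 = (t : ℂ) ^ 4 / (r : ℂ) ^ 2 := by
    rw [eq_div_iff (pow_ne_zero 2 hr')]
    norm_num at key
    linear_combination key / 2
  exact hderiv ▸ hdiff.hasDerivAt

/-- The logarithm of the dominant eigenvalue, as a function of `c = cosh z`. -/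
lemma hasDerivAt_log_dominant_root {r t : ℝ} (hr : r ≠ 0) (hrt : r ^ 2 + t ^ 2 = 1) :
    HasDerivAt (fun c : ℂ => log ((t : ℂ) ^ 2 * c + discSqrt r t c))
      ((t : ℂ) ^ 2 / (r : ℂ) ^ 2) 1 := by
  have hr' : (r : ℂ) ≠ 0 := by exact_mod_cast hr
  have hrt' : (r : ℂ) ^ 2 + (t : ℂ) ^ 2 = 1 := mod_cast hrt
  have h1 : (t : ℂ) ^ 2 * 1 + discSqrt r t 1 = 1 := by
    rw [discSqrt_one hrt, mul_one, add_comm, hrt']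
  have hp : HasDerivAt (fun c : ℂ => (t : ℂ) ^ 2 * c + discSqrt r t c)
      ((t : ℂ) ^ 2 * 1 + (t : ℂ) ^ 4 / (r : ℂ) ^ 2) 1 :=
    ((hasDerivAt_id (1 : ℂ)).const_mul ((t : ℂ) ^ 2)).add (hasDerivAt_discSqrt hr hrt)
  have h := hp.clog (by rw [h1]; exact one_mem_slitPlane)
  convert h using 1
  rw [h1, div_one]
  field_simp
  linear_combination -(t : ℂ) ^ 2 * hrt'

lemma tendsto_walkGF {α : Type*} {l : Filter α} (a : ℝ) {r t : ℝ} (hr : 0 < r) (ht : 0 < t)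
    (hrt : r ^ 2 + t ^ 2 = 1) {z : α → ℂ} {m : α → ℕ} {L : ℂ} (hz : Tendsto z l (nhds 0))
    (hm : Tendsto (fun i => ((m i + 1 : ℕ) : ℂ) * (cosh (z i) - 1)) l (nhds L)) :
    Tendsto (fun i => walkGF a r t (z i) (m i)) l
      (nhds (exp ((t : ℂ) ^ 2 / (r : ℂ) ^ 2 * L))) := by
  have hr' : (r : ℂ) ≠ 0 := by exact_mod_cast hr.ne'
  have hrt' : (r : ℂ) ^ 2 + (t : ℂ) ^ 2 = 1 := mod_cast hrt
  have hrt₁ : (t : ℂ) ^ 2 + (r : ℂ) ^ 2 = 1 := by rw [← hrt']; ring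
  have hc : Tendsto (fun i => cosh (z i)) l (nhds 1) := by
    simpa [Function.comp_def] using (continuous_cosh.tendsto 0).comp hz
  have hs : Tendsto (fun i => discSqrt r t (cosh (z i))) l (nhds ((r : ℂ) ^ 2)) := by
    have := (hasDerivAt_discSqrt hr.ne' hrt).continuousAt.tendsto.comp hc
    rwa [discSqrt_one hrt] at this
  set p : α → ℂ := fun i => (t : ℂ) ^ 2 * cosh (z i) + discSqrt r t (cosh (z i)) with hp
  set q : α → ℂ := fun i => (t : ℂ) ^ 2 * cosh (z i) - discSqrt r t (cosh (z i)) with hq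
  have hp1 : Tendsto p l (nhds 1) := by
    rw [← hrt₁]
    simpa using (hc.const_mul ((t : ℂ) ^ 2)).add hs
  have hq1 : Tendsto q l (nhds ((t : ℂ) ^ 2 - (r : ℂ) ^ 2)) := by
    simpa using (hc.const_mul ((t : ℂ) ^ 2)).sub hs
  have hne : (1 : ℂ) - ((t : ℂ) ^ 2 - (r : ℂ) ^ 2) ≠ 0 := by
    rw [← hrt']
    ring_nf
    simpa using hr'
  have hpq : ∀ᶠ i in l, p i - q i ≠ 0 := (hp1.sub hq1).eventually_ne hne
  have hF0 : Tendsto (fun i => walkGF a r t (z i) 0) l (nhds 1) := by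
    have : Continuous fun z => walkGF a r t z 0 := by
      simp only [walkGF_zero]; fun_prop
    simpa [walkGF_zero, Function.comp_def] using (this.tendsto 0).comp hz
  have hF1 : Tendsto (fun i => walkGF a r t (z i) 1) l (nhds 1) := by
    have hcont : Continuous fun z => walkGF a r t z 1 := by
      simp only [walkGF_one]; fun_prop
    have hval : walkGF a r t 0 1 = 1 := by
      simp only [walkGF_one, neg_zero, exp_zero]
      linear_combination hrt'
    have := (hcont.tendsto 0).comp hz
    rwa [hval] at this
  have hA : Tendsto (fun i => (walkGF a r t (z i) 1 - q i * walkGF a r t (z i) 0) / (p i - q i)) l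
      (nhds 1) := by
    have := (hF1.sub (hq1.mul hF0)).div (hp1.sub hq1) hne
    rwa [mul_one, div_self hne] at this
  have hB : Tendsto (fun i => (walkGF a r t (z i) 1 - p i * walkGF a r t (z i) 0) / (p i - q i)) l
      (nhds 0) := by
    have := (hF1.sub (hp1.mul hF0)).div (hp1.sub hq1) hne
    rwa [mul_one, sub_self, zero_div] at this
  have hqm : ∀ᶠ i in l, ‖q i ^ m i‖ ≤ 1 := by
    have hlt : ‖(t : ℂ) ^ 2 - (r : ℂ) ^ 2‖ < 1 := by
      rw [← ofReal_pow, ← ofReal_pow, ← ofReal_sub, norm_real, Real.norm_eq_abs, abs_lt]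
      constructor <;> nlinarith [pow_pos hr 2, pow_pos ht 2]
    filter_upwards [hq1.norm.eventually_lt_const hlt] with i hi
    rw [norm_pow]
    exact pow_le_one₀ (norm_nonneg _) hi.le
  have hBq : Tendsto (fun i => (walkGF a r t (z i) 1 - p i * walkGF a r t (z i) 0) /
      (p i - q i) * q i ^ m i) l (nhds 0) := by
    refine squeeze_zero_norm' ?_ (norm_zero (E := ℂ) ▸ hB.norm)
    filter_upwards [hqm] with i hi
    rw [norm_mul]
    exact mul_le_of_le_one_right (norm_nonneg _) hi
  have hlog1 : log ((t : ℂ) ^ 2 * 1 + discSqrt r t 1) = 0 := by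
    rw [discSqrt_one hrt, mul_one, hrt₁, log_one]
  have hlog : Tendsto (fun i => ((m i + 1 : ℕ) : ℂ) * log (p i)) l
      (nhds ((t : ℂ) ^ 2 / (r : ℂ) ^ 2 * L)) :=
    tendsto_mul_comp_of_hasDerivAt (hasDerivAt_log_dominant_root hr.ne' hrt) hlog1 hc hm
  have hpm : Tendsto (fun i => p i ^ m i) l (nhds (exp ((t : ℂ) ^ 2 / (r : ℂ) ^ 2 * L))) := by
    have h := ((continuous_exp.tendsto _).comp hlog).div hp1 one_ne_zero
    rw [div_one] at h
    refine h.congr' ?_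
    filter_upwards [hp1.eventually_ne one_ne_zero] with i hi
    simp only [Pi.div_apply, Function.comp_apply]
    rw [exp_nat_mul, exp_log hi, pow_succ, mul_div_cancel_right₀ _ hi]
  have h := (hA.mul hpm).sub hBq
  rw [one_mul, sub_zero] at h
  refine h.congr' ?_
  filter_upwards [hpq] with i hi
  have hrec : ∀ k, walkGF a r t (z i) (k + 2) =
      (p i + q i) * walkGF a r t (z i) (k + 1) - p i * q i * walkGF a r t (z i) k := by
    intro k
    rw [walkGF_add_two a hrt]
    have := discSqrt_sq r t (cosh (z i))
    simp only [hp, hq]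
    linear_combination (-walkGF a r t (z i) k) * this
  have := binet_of_recurrence hrec (m i)
  field_simp
  linear_combination -this

lemma tendsto_mul_cosh_sub_one {α : Type*} {l : Filter α} {s z : α → ℂ} {L : ℂ}
    (hz : Tendsto z l (nhds 0)) (hsz : Tendsto (fun i => s i * z i) l (nhds L)) :
    Tendsto (fun i => s i ^ 2 * (cosh (z i) - 1)) l (nhds (L ^ 2 / 2)) := by
  have hd : HasDerivAt (fun x : ℂ => sinh (x / 2)) (1 / 2) 0 := by
    simpa using ((hasDerivAt_id (0 : ℂ)).div_const 2).csinh
  have h := ((tendsto_mul_comp_of_hasDerivAt hd (by simp) hz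
    (by simpa using hsz)).pow 2).const_mul 2
  convert h using 2 with i
  · have h₂ : cosh (z i) = cosh (2 * (z i / 2)) := by ring_nf
    rw [h₂, cosh_two_mul, cosh_sq]
    ring
  · ring

lemma tendsto_walkGF_diffusive (a : ℝ) {r t : ℝ} (hr : 0 < r) (ht : 0 < t)
    (hrt : r ^ 2 + t ^ 2 = 1) {n : ℕ} (hn : 1 ≤ n) (y : ℂ) :
    Tendsto
      (fun x : ℕ × ℂ => ∑ k ∈ Finset.Icc (-(x.1 * n : ℤ)) (x.1 * n),
        exp (I * x.2 * k / (Real.sqrt x.1 : ℝ)) * (w a r t (x.1 * n) k : ℂ))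
      (atTop ×ˢ nhds y)
      (nhds (exp (-(n : ℂ) * ((t : ℂ) ^ 2 / (2 * (r : ℂ) ^ 2)) * y ^ 2))) := by
  have hτ : Tendsto (fun x : ℕ × ℂ => x.1) (atTop ×ˢ nhds y) atTop := tendsto_fst
  have hy : Tendsto (fun x : ℕ × ℂ => x.2) (atTop ×ˢ nhds y) (nhds y) := tendsto_snd
  have hpos : ∀ᶠ x : ℕ × ℂ in atTop ×ˢ nhds y, 0 < x.1 := hτ.eventually_gt_atTop 0
  have hsqrt : Tendsto (fun x : ℕ × ℂ => ((Real.sqrt x.1 : ℝ) : ℂ)⁻¹) (atTop ×ˢ nhds y)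
      (nhds 0) := by
    have h : Tendsto (fun x : ℕ × ℂ => (Real.sqrt x.1)⁻¹) (atTop ×ˢ nhds y) (nhds 0) :=
      tendsto_inv_atTop_zero.comp
        (Real.tendsto_sqrt_atTop.comp (tendsto_natCast_atTop_atTop.comp hτ))
    simpa [Function.comp_def] using (continuous_ofReal.tendsto 0).comp h
  have hz : Tendsto (fun x : ℕ × ℂ => I * x.2 / (Real.sqrt x.1 : ℝ)) (atTop ×ˢ nhds y)
      (nhds 0) := by
    simpa [div_eq_mul_inv] using (hy.const_mul I).mul hsqrt
  have hsz : Tendsto (fun x : ℕ × ℂ => ((Real.sqrt x.1 : ℝ) : ℂ) *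
      (I * x.2 / (Real.sqrt x.1 : ℝ))) (atTop ×ˢ nhds y) (nhds (I * y)) := by
    refine (hy.const_mul I).congr' ?_
    filter_upwards [hpos] with x hx
    have : ((Real.sqrt x.1 : ℝ) : ℂ) ≠ 0 := by
      exact_mod_cast (Real.sqrt_pos.2 (Nat.cast_pos.2 hx)).ne'
    field_simp
  have hm : Tendsto (fun x : ℕ × ℂ => ((x.1 * n - 1 + 1 : ℕ) : ℂ) *
      (cosh (I * x.2 / (Real.sqrt x.1 : ℝ)) - 1)) (atTop ×ˢ nhds y)
      (nhds (n * ((I * y) ^ 2 / 2))) := by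
    refine ((tendsto_mul_cosh_sub_one hz hsz).const_mul (n : ℂ)).congr' ?_
    filter_upwards [hpos] with x hx
    rw [Nat.sub_add_cancel (Nat.mul_pos hx hn), ← ofReal_pow, Real.sq_sqrt (Nat.cast_nonneg _)]
    push_cast
    ring
  have h := tendsto_walkGF a hr ht hrt hz hm
  rw [show (t : ℂ) ^ 2 / (r : ℂ) ^ 2 * (n * ((I * y) ^ 2 / 2)) =
      -(n : ℂ) * ((t : ℂ) ^ 2 / (2 * (r : ℂ) ^ 2)) * y ^ 2 by
    rw [mul_pow, I_sq]; ring] at h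
  refine h.congr' ?_
  filter_upwards [hpos] with x hx
  rw [← sum_exp_mul_w_succ, Nat.sub_add_cancel (Nat.mul_pos hx hn)]
  push_cast
  refine Finset.sum_congr rfl fun k _ => ?_
  congr 2
  ring

/-- Lemma 4.4: under diffusive scaling, the generating function of the persistent random
walk converges to a Gaussian: for every `n ≥ 1`,
`Σ_{k=-τn}^{τn} e^{iyk/√τ} w_k(τn) → e^{-n t²/(2r²) y²}` as `τ → ∞`,
uniformly for `y` in compact subsets of `ℂ`. -/
theorem generating_function_gaussian_limit
    (r t : ℝ) (hr0 : 0 < r) (hr1 : r < 1) (ht0 : 0 < t) (ht1 : t < 1)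
    (hrt : r ^ 2 + t ^ 2 = 1) (a : ℝ) (ha0 : 0 ≤ a) (ha1 : a ≤ 1)
    (n : ℕ) (hn : 1 ≤ n) :
    (∀ y : ℂ, Tendsto
      (fun τ : ℕ => ∑ k ∈ Finset.Icc (-(τ * n : ℤ)) (τ * n),
        Complex.exp (Complex.I * y * k / (Real.sqrt τ : ℝ)) * (w a r t (τ * n) k : ℂ))
      atTop
      (nhds (Complex.exp (-(n : ℂ) * ((t : ℂ) ^ 2 / (2 * (r : ℂ) ^ 2)) * y ^ 2)))) ∧
    (∀ K : Set ℂ, IsCompact K → TendstoUniformlyOn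
      (fun (τ : ℕ) (y : ℂ) => ∑ k ∈ Finset.Icc (-(τ * n : ℤ)) (τ * n),
        Complex.exp (Complex.I * y * k / (Real.sqrt τ : ℝ)) * (w a r t (τ * n) k : ℂ))
      (fun y : ℂ => Complex.exp (-(n : ℂ) * ((t : ℂ) ^ 2 / (2 * (r : ℂ) ^ 2)) * y ^ 2))
      atTop K) := by
  have h := fun y => tendsto_walkGF_diffusive a hr0 ht0 hrt hn y
  refine ⟨fun y => ?_, fun K hK => ?_⟩
  · have hτ : Tendsto (fun τ : ℕ => (τ, y)) atTop (atTop ×ˢ nhds y) :=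
      tendsto_id.prodMk tendsto_const_nhds
    simpa only [Function.comp_def] using (h y).comp hτ
  rw [← tendstoLocallyUniformlyOn_iff_tendstoUniformlyOn_of_compact hK]
  refine TendstoLocallyUniformly.tendstoLocallyUniformlyOn ?_
  rw [tendstoLocallyUniformly_iff_filter]
  intro y
  rw [tendstoUniformlyOnFilter_iff_tendsto]
  have hcont : Continuous fun y : ℂ =>
      exp (-(n : ℂ) * ((t : ℂ) ^ 2 / (2 * (r : ℂ) ^ 2)) * y ^ 2) := by fun_prop
  have hy := (((hcont.tendsto y).comp tendsto_snd).prodMk_nhds (h y))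
  exact hy.mono_right (nhds_le_uniformity _)

end QWStmt16
end
end

section
/- For every L ∈ ℕ, lim_{τ→∞, τ∈ℕ} Σ_{k=−τ}^{τ} (i k)^L τ^{−L/2} w_k(τ) = (t²/r²)^{L/2} H_L(0) (−1)^L, where H_L denotes the Hermite polynomial H_L(z) = (−1)^L e^{z²/2} (d/dz)^L e^{−z²/2}. In particular, the L-th moment of the persistent random walk, rescaled by τ^{L/2}, converges to the L-th moment of a centered Gaussian of variance t²/r². -/
open MeasureTheory Complex Filter

noncomputable section

namespace QWStmt17

/-- sign of a step: `true ↦ +1`, `false ↦ -1`. -/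
def sgn (b : Bool) : ℤ := if b then 1 else -1

/-- Path probability of the persistent random walk with initial probability `a` of
stepping right, persistence probability `t²` and flip probability `r²`. -/
def prw (a r t : ℝ) {n : ℕ} (σ : Fin n → Bool) : ℝ :=
  ∏ j : Fin n,
    if (j : ℕ) = 0 then (if σ j then a else 1 - a)
    else (if σ j = σ ⟨(j : ℕ) - 1, lt_of_le_of_lt (Nat.sub_le _ _) j.isLt⟩
          then t ^ 2 else r ^ 2)

/-- `w k n = P(S_n = k)`, the distribution of the persistent random walk. -/
def w (a r t : ℝ) (n : ℕ) (k : ℤ) : ℝ :=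
  ∑ σ : Fin n → Bool, if (∑ j : Fin n, sgn (σ j)) = k then prw a r t σ else 0

lemma sgn_eq_one_or_neg_one (b : Bool) : sgn b = 1 ∨ sgn b = -1 := by
  cases b <;> simp [sgn]

lemma prw_nonneg {a : ℝ} (ha0 : 0 ≤ a) (ha1 : a ≤ 1) (r t : ℝ) {n : ℕ} (σ : Fin n → Bool) :
    0 ≤ prw a r t σ := by
  refine Finset.prod_nonneg fun j _ => ?_
  have : 0 ≤ 1 - a := sub_nonneg.2 ha1
  split_ifs <;> positivity

lemma prw_snoc (a r t : ℝ) {n : ℕ} (σ : Fin (n + 1) → Bool) (b : Bool) :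
    prw a r t (Fin.snoc (α := fun _ => Bool) σ b) =
      prw a r t σ * if b = σ (Fin.last n) then t ^ 2 else r ^ 2 := by
  unfold prw
  rw [Fin.prod_univ_castSucc]
  congr 1
  · refine Finset.prod_congr rfl fun j _ => ?_
    have h : (⟨(j.castSucc : ℕ) - 1, lt_of_le_of_lt (Nat.sub_le _ _) j.castSucc.isLt⟩ :
        Fin (n + 1 + 1)) =
        Fin.castSucc ⟨(j : ℕ) - 1, lt_of_le_of_lt (Nat.sub_le _ _) j.isLt⟩ := rfl
    rw [h, Fin.snoc_castSucc, Fin.snoc_castSucc]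
    rfl
  · have h : (⟨(Fin.last (n + 1) : ℕ) - 1,
        lt_of_le_of_lt (Nat.sub_le _ _) (Fin.last (n + 1)).isLt⟩ : Fin (n + 1 + 1)) =
        Fin.castSucc (Fin.last n) := by ext; simp
    rw [h, Fin.snoc_castSucc, Fin.snoc_last]
    simp

/-- Expectation of `F S σ`, with `S` the position of the walk after `n + 1` steps and `σ` its
last step. -/
def walkExp (a r t : ℝ) (n : ℕ) (F : ℝ → ℝ → ℝ) : ℝ :=
  ∑ σ : Fin (n + 1) → Bool,
    prw a r t σ * F ((∑ j, sgn (σ j) : ℤ) : ℝ) (sgn (σ (Fin.last n)) : ℝ)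

section walkExp

variable (a r t : ℝ) (n : ℕ)

lemma walkExp_congr {F G : ℝ → ℝ → ℝ} (h1 : ∀ x, F x 1 = G x 1) (h2 : ∀ x, F x (-1) = G x (-1)) :
    walkExp a r t n F = walkExp a r t n G := by
  refine Finset.sum_congr rfl fun σ _ => ?_
  rcases sgn_eq_one_or_neg_one (σ (Fin.last n)) with h | h <;> simp [h, h1, h2]

lemma walkExp_add (F G : ℝ → ℝ → ℝ) :
    walkExp a r t n (fun x s => F x s + G x s) = walkExp a r t n F + walkExp a r t n G := by
  simp [walkExp, mul_add, Finset.sum_add_distrib]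

lemma walkExp_const_mul (c : ℝ) (F : ℝ → ℝ → ℝ) :
    walkExp a r t n (fun x s => c * F x s) = c * walkExp a r t n F := by
  simp [walkExp, Finset.mul_sum, mul_left_comm]

lemma walkExp_sum {ι : Type*} (u : Finset ι) (F : ι → ℝ → ℝ → ℝ) :
    walkExp a r t n (fun x s => ∑ i ∈ u, F i x s) = ∑ i ∈ u, walkExp a r t n (F i) := by
  simp only [walkExp, Finset.mul_sum]
  exact Finset.sum_comm

lemma walkExp_succ (F : ℝ → ℝ → ℝ) :
    walkExp a r t (n + 1) F =
      walkExp a r t n (fun x s => t ^ 2 * F (x + s) s + r ^ 2 * F (x - s) (-s)) := by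
  unfold walkExp
  rw [← (Fin.snocEquiv (fun _ : Fin (n + 2) => Bool)).sum_comp, Fintype.sum_prod_type_right]
  refine Finset.sum_congr rfl fun σ _ => ?_
  simp only [Fin.snocEquiv, Equiv.coe_fn_mk, prw_snoc, Fin.sum_univ_castSucc (n := n + 1),
    Fin.snoc_castSucc, Fin.snoc_last, Fintype.sum_bool]
  cases h : σ (Fin.last n) <;> simp [sgn] <;> ring_nf

lemma walkExp_one (hrt : r ^ 2 + t ^ 2 = 1) : walkExp a r t n (fun _ _ => 1) = 1 := by
  induction n with
  | zero =>
    unfold walkExp prw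
    rw [← (Equiv.funUnique (Fin 1) Bool).symm.sum_comp]
    simp
  | succ n ih =>
    rw [walkExp_succ]
    refine Eq.trans ?_ ih
    apply walkExp_congr <;> intro x <;> linarith

variable {a}

lemma walkExp_mono (ha0 : 0 ≤ a) (ha1 : a ≤ 1) {F G : ℝ → ℝ → ℝ}
    (h1 : ∀ x, F x 1 ≤ G x 1) (h2 : ∀ x, F x (-1) ≤ G x (-1)) :
    walkExp a r t n F ≤ walkExp a r t n G := by
  refine Finset.sum_le_sum fun σ _ => mul_le_mul_of_nonneg_left ?_ (prw_nonneg ha0 ha1 r t σ)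
  rcases sgn_eq_one_or_neg_one (σ (Fin.last n)) with h | h <;> simp [h, h1, h2]

lemma abs_walkExp_le (ha0 : 0 ≤ a) (ha1 : a ≤ 1) (F : ℝ → ℝ → ℝ) :
    |walkExp a r t n F| ≤ walkExp a r t n (fun x s => |F x s|) := by
  refine (Finset.abs_sum_le_sum_abs _ _).trans (Finset.sum_le_sum fun σ _ => ?_)
  rw [abs_mul, abs_of_nonneg (prw_nonneg ha0 ha1 r t σ)]

end walkExp

/-- A Stolz-Cesàro theorem for powers. -/
lemma tendsto_div_rpow_of_tendsto_increment {u : ℕ → ℝ} {q c : ℝ} (hq : 0 < q)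
    (h : Tendsto (fun n => (u (n + 1) - u n) / ((n : ℝ) + 1) ^ (q - 1)) atTop (nhds c)) :
    Tendsto (fun n => u n / ((n : ℝ) + 1) ^ q) atTop (nhds (c / q)) := by
  set g : ℕ → ℝ := fun n => ((n : ℝ) + 2) ^ q - ((n : ℝ) + 1) ^ q with hg
  have hpos : ∀ n : ℕ, 0 < ((n : ℝ) + 1) := fun n => by positivity
  have hinv : Tendsto (fun n : ℕ => ((n : ℝ) + 1)⁻¹) atTop (nhdsWithin 0 {0}ᶜ) := by
    refine tendsto_nhdsWithin_iff.2 ⟨?_, Eventually.of_forall fun n => (inv_pos.2 (hpos n)).ne'⟩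
    simpa using tendsto_one_div_add_atTop_nhds_zero_nat (𝕜 := ℝ)
  have hgq : Tendsto (fun n => g n / ((n : ℝ) + 1) ^ (q - 1)) atTop (nhds q) := by
    have hd : HasDerivAt (fun x : ℝ => x ^ q) q 1 := by
      simpa using Real.hasDerivAt_rpow_const (x := 1) (p := q) (Or.inl one_ne_zero)
    refine (hd.tendsto_slope_zero.comp hinv).congr fun n => ?_
    have h1 : (n : ℝ) + 2 = (n + 1) * (1 + ((n : ℝ) + 1)⁻¹) := by
      field_simp; ring
    simp only [hg, Function.comp, inv_inv, smul_eq_mul, Real.one_rpow]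
    rw [h1, Real.mul_rpow (hpos n).le (by positivity), Real.rpow_sub_one (hpos n).ne']
    field_simp
  have hgpos : ∀ n, 0 < g n := fun n =>
    sub_pos.2 (Real.rpow_lt_rpow (hpos n).le (by linarith) hq)
  have hsum : ∀ n, ∑ i ∈ Finset.range n, g i = ((n : ℝ) + 1) ^ q - 1 := fun n => by
    have := Finset.sum_range_sub (fun i : ℕ => ((i : ℝ) + 1) ^ q) n
    simp only [Nat.cast_zero, zero_add, Real.one_rpow] at this
    rw [← this]
    refine Finset.sum_congr rfl fun i _ => ?_
    simp only [hg]; push_cast; ring_nf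
  have hNtop : Tendsto (fun n : ℕ => ((n : ℝ) + 1) ^ q) atTop atTop :=
    (tendsto_rpow_atTop hq).comp (tendsto_atTop_add_const_right _ _ tendsto_natCast_atTop_atTop)
  have hsumtop : Tendsto (fun n => ∑ i ∈ Finset.range n, g i) atTop atTop := by
    simp only [hsum]
    exact tendsto_atTop_add_const_right _ _ hNtop
  have hlo : (fun n => u (n + 1) - u n - c / q * g n) =o[atTop] g := by
    refine (Asymptotics.isLittleO_iff_tendsto' (Eventually.of_forall fun n hn =>
      absurd hn (hgpos n).ne')).2 ?_
    have := (h.div hgq hq.ne').sub_const (c / q)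
    rw [sub_self] at this
    refine this.congr fun n => ?_
    have := (hgpos n).ne'
    have := (Real.rpow_pos_of_pos (hpos n) (q - 1)).ne'
    simp only [Pi.div_apply]
    field_simp
  have hS := (hlo.sum_range (fun n => (hgpos n).le) hsumtop).tendsto_div_nhds_zero
  have hS' := (hS.mul ((tendsto_const_nhds (x := (1 : ℝ))).sub
    hNtop.inv_tendsto_atTop)).add
      ((hNtop.inv_tendsto_atTop.const_mul (u 0 - c / q)).add_const (c / q))
  simp only [mul_zero, zero_mul, zero_add] at hS'
  refine hS'.congr' ?_
  filter_upwards [hsumtop.eventually_gt_atTop 0] with n hn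
  have h0 := (Real.rpow_pos_of_pos (hpos n) q).ne'
  rw [hsum] at hn
  rw [Finset.sum_sub_distrib, Finset.sum_range_sub, ← Finset.mul_sum, hsum]
  have := hn.ne'
  simp only [Pi.inv_apply]
  field_simp
  ring

lemma tendsto_div_rpow_zero_of_le {u : ℕ → ℝ} {C p q : ℝ} (hpq : p < q)
    (h : ∀ n, |u n| ≤ C * ((n : ℝ) + 1) ^ p) :
    Tendsto (fun n => u n / ((n : ℝ) + 1) ^ q) atTop (nhds 0) := by
  have hN : Tendsto (fun n : ℕ => (n : ℝ) + 1) atTop atTop :=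
    tendsto_atTop_add_const_right _ _ tendsto_natCast_atTop_atTop
  have h0 := ((tendsto_rpow_neg_atTop (sub_pos.2 hpq)).comp hN).const_mul C
  rw [mul_zero] at h0
  refine squeeze_zero_norm (fun n => ?_) h0
  have hpos : (0 : ℝ) < (n : ℝ) + 1 := by positivity
  have hq := Real.rpow_pos_of_pos hpos q
  rw [Real.norm_eq_abs, abs_div, abs_of_pos hq, div_le_iff₀ hq, Function.comp, mul_assoc,
    ← Real.rpow_add hpos]
  simpa using h n

/-- The moments of a centered Gaussian of variance `v`. -/
def gaussMoment (v : ℝ) : ℕ → ℝ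
  | 0 => 1
  | 1 => 0
  | L + 2 => (L + 1) * v * gaussMoment v L

lemma gaussMoment_two_mul (v : ℝ) (m : ℕ) :
    gaussMoment v (2 * m) = v ^ m * (Nat.doubleFactorial (2 * m - 1) : ℝ) := by
  induction m with
  | zero => simp [gaussMoment]
  | succ m ih =>
    rw [Nat.mul_succ, gaussMoment, ih, show 2 * m + 2 - 1 = 2 * m + 1 by omega,
      Nat.doubleFactorial_add_one]
    push_cast
    ring

lemma gaussMoment_two_mul_add_one (v : ℝ) (m : ℕ) : gaussMoment v (2 * m + 1) = 0 := by
  induction m with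
  | zero => simp [gaussMoment]
  | succ m ih => rw [show 2 * (m + 1) + 1 = 2 * m + 1 + 2 by ring, gaussMoment, ih, mul_zero]

lemma I_pow_mul_gaussMoment (v : ℝ) (L : ℕ) :
    Complex.I ^ L * (gaussMoment v L : ℂ) =
      ((v ^ ((L : ℝ) / 2) * ((Polynomial.hermite L).eval 0 : ℤ) * (-1) ^ L : ℝ) : ℂ) := by
  rw [← Polynomial.coeff_zero_eq_eval_zero]
  obtain ⟨m, rfl | rfl⟩ := L.even_or_odd'
  · have h := Polynomial.coeff_hermite_explicit m 0
    have hm : ((2 * m : ℕ) : ℝ) / 2 = m := by push_cast; ring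
    rw [add_zero] at h
    rw [h, gaussMoment_two_mul, hm, Real.rpow_natCast, pow_mul, Complex.I_sq, pow_mul]
    push_cast
    simp
    ring
  · rw [gaussMoment_two_mul_add_one, Polynomial.coeff_hermite_of_odd_add (by simp)]
    simp

lemma add_pow_eq_sum_lower (y d : ℝ) (L : ℕ) :
    (y + d) ^ L = ∑ j ∈ Finset.range L, (d ^ (L - j) * L.choose j) * y ^ j + y ^ L := by
  rw [add_pow, Finset.sum_range_succ]
  congr 1
  · exact Finset.sum_congr rfl fun j _ => by ring
  · simp

lemma add_pow_add_two (y d : ℝ) (l : ℕ) :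
    (y + d) ^ (l + 2) =
      ∑ j ∈ Finset.range l, (d ^ (l + 2 - j) * (l + 2).choose j) * y ^ j +
        (l + 2) * (l + 1) / 2 * d ^ 2 * y ^ l + (l + 2) * d * y ^ (l + 1) + y ^ (l + 2) := by
  have h : ((l + 2).choose l : ℝ) = (l + 2) * (l + 1) / 2 := by
    rw [Nat.choose_symm_add, Nat.cast_choose_two]
    push_cast
    ring
  rw [add_pow_eq_sum_lower, Finset.sum_range_succ, Finset.sum_range_succ, h,
    show l + 2 - l = 2 by omega, show l + 2 - (l + 1) = 1 by omega,
    show l + 2 = l + 1 + 1 from rfl, Nat.choose_succ_self_right]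
  push_cast
  ring

/-- The `L`-th moment of `S + c σ`, where `S` is the position of the walk after `n + 1` steps
and `σ` its last step. -/
def corrMoment (a r t c : ℝ) (L n : ℕ) : ℝ :=
  walkExp a r t n (fun x s => (x + c * s) ^ L)

section moments

variable {a r t : ℝ}

lemma exists_walkExp_abs_pow_le {c : ℝ} (ha0 : 0 ≤ a) (ha1 : a ≤ 1) {g : ℕ → ℝ} {k : ℕ}
    (h : ∀ j ≤ k + 1, Tendsto (fun n : ℕ => corrMoment a r t c j n / ((n : ℝ) + 1) ^ ((j : ℝ) / 2))
      atTop (nhds (g j))) :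
    ∃ C, ∀ n : ℕ, walkExp a r t n (fun x s => |x + c * s| ^ k) ≤
      C * ((n : ℝ) + 1) ^ ((k : ℝ) / 2) := by
  have hb : ∀ j ≤ k + 1, ∃ C, ∀ n : ℕ, corrMoment a r t c j n ≤
      C * ((n : ℝ) + 1) ^ ((j : ℝ) / 2) := fun j hj => by
    obtain ⟨C, hC⟩ := (h j hj).bddAbove_range
    refine ⟨C, fun n => ?_⟩
    have := hC ⟨n, rfl⟩
    rwa [div_le_iff₀ (by positivity)] at this
  rcases k.even_or_odd with hk | hk
  · obtain ⟨C, hC⟩ := hb k (by omega)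
    exact ⟨C, fun n => by simpa only [hk.pow_abs, corrMoment] using hC n⟩
  · obtain ⟨m, rfl⟩ := hk
    obtain ⟨C, hC⟩ := hb (2 * m) (by omega)
    obtain ⟨D, hD⟩ := hb (2 * m + 2) (by omega)
    refine ⟨C + D, fun n => ?_⟩
    have hpos : (0 : ℝ) < (n : ℝ) + 1 := by positivity
    set z : ℝ := ((n : ℝ) + 1) ^ ((1 : ℝ) / 2) with hz
    have hz0 : 0 < z := Real.rpow_pos_of_pos hpos _
    have hy : ∀ y : ℝ, |y| ^ (2 * m + 1) ≤ z * y ^ (2 * m) + z⁻¹ * y ^ (2 * m + 2) := fun y => by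
      have h1 : |y| ≤ z + z⁻¹ * y ^ 2 := by
        rw [← sq_abs y, ← sub_nonneg]
        have : z + z⁻¹ * |y| ^ 2 - |y| = z⁻¹ * ((z - |y|) ^ 2 + z * |y|) := by
          field_simp; ring
        rw [this]
        positivity
      have h2 : |y| ^ (2 * m) = y ^ (2 * m) := (even_two_mul m).pow_abs y
      have h3 : 0 ≤ y ^ (2 * m) := (even_two_mul m).pow_nonneg y
      calc |y| ^ (2 * m + 1) = y ^ (2 * m) * |y| := by rw [pow_succ, h2]
        _ ≤ y ^ (2 * m) * (z + z⁻¹ * y ^ 2) := mul_le_mul_of_nonneg_left h1 h3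
        _ = _ := by ring
    refine (walkExp_mono r t n ha0 ha1
      (G := fun x s => z * (x + c * s) ^ (2 * m) + z⁻¹ * (x + c * s) ^ (2 * m + 2))
      (fun x => hy _) (fun x => hy _)).trans ?_
    rw [walkExp_add, walkExp_const_mul, walkExp_const_mul]
    have e1 : z * ((n : ℝ) + 1) ^ (((2 * m : ℕ) : ℝ) / 2) =
        ((n : ℝ) + 1) ^ (((2 * m + 1 : ℕ) : ℝ) / 2) := by
      rw [hz, ← Real.rpow_add hpos]
      congr 1; push_cast; ring
    have e2 : z⁻¹ * ((n : ℝ) + 1) ^ (((2 * m + 2 : ℕ) : ℝ) / 2) =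
        ((n : ℝ) + 1) ^ (((2 * m + 1 : ℕ) : ℝ) / 2) := by
      rw [hz, ← Real.rpow_neg hpos.le, ← Real.rpow_add hpos]
      congr 1; push_cast; ring
    have h1 := mul_le_mul_of_nonneg_left (hC n) hz0.le
    have h2 := mul_le_mul_of_nonneg_left (hD n) (inv_pos.2 hz0).le
    rw [mul_left_comm, e1] at h1
    rw [mul_left_comm, e2] at h2
    rw [add_mul]
    exact add_le_add h1 h2

lemma tendsto_walkExp_lower_terms {c : ℝ} (ha0 : 0 ≤ a) (ha1 : a ≤ 1) {g : ℕ → ℝ} {l : ℕ}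
    (h : ∀ j ≤ l, Tendsto (fun n : ℕ => corrMoment a r t c j n / ((n : ℝ) + 1) ^ ((j : ℝ) / 2))
      atTop (nhds (g j))) (G : ℕ → ℝ → ℝ) :
    Tendsto (fun n : ℕ => walkExp a r t n
      (fun x s => ∑ j ∈ Finset.range l, G j s * (x + c * s) ^ j) / ((n : ℝ) + 1) ^ ((l : ℝ) / 2))
      atTop (nhds 0) := by
  simp only [walkExp_sum, Finset.sum_div]
  have h0 : (0 : ℝ) = ∑ _j ∈ Finset.range l, 0 := by simp
  refine h0 ▸ tendsto_finsetSum _ fun j hj => ?_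
  have hjl := Finset.mem_range.1 hj
  obtain ⟨C, hC⟩ := exists_walkExp_abs_pow_le (k := j) ha0 ha1 fun i hi => h i (by omega)
  have hlt : (j : ℝ) / 2 < (l : ℝ) / 2 := by
    have : (j : ℝ) < l := by exact_mod_cast hjl
    linarith
  refine tendsto_div_rpow_zero_of_le (C := (|G j 1| + |G j (-1)|) * C) hlt fun n => ?_
  refine (abs_walkExp_le r t n ha0 ha1 _).trans ?_
  rw [mul_assoc]
  refine le_trans ?_ (mul_le_mul_of_nonneg_left (hC n) (by positivity))
  rw [← walkExp_const_mul]
  refine walkExp_mono r t n ha0 ha1 (fun x => ?_) (fun x => ?_) <;> rw [abs_mul, abs_pow] <;>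
    refine mul_le_mul_of_nonneg_right ?_ (by positivity)
  · linarith [abs_nonneg (G j (-1))]
  · linarith [abs_nonneg (G j 1)]

lemma tendsto_corrMoment (ha0 : 0 ≤ a) (ha1 : a ≤ 1) (hr : r ≠ 0) (hrt : r ^ 2 + t ^ 2 = 1)
    (L : ℕ) :
    Tendsto (fun n : ℕ => corrMoment a r t ((t ^ 2 / r ^ 2 - 1) / 2) L n /
      ((n : ℝ) + 1) ^ ((L : ℝ) / 2)) atTop (nhds (gaussMoment (t ^ 2 / r ^ 2) L)) := by
  set v := t ^ 2 / r ^ 2 with hv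
  set c := (v - 1) / 2 with hc
  have hrv : r ^ 2 * v = t ^ 2 := by rw [hv]; field_simp
  have hstep : ∀ k n, corrMoment a r t c k (n + 1) = walkExp a r t n (fun x s =>
      t ^ 2 * ((x + c * s) + s) ^ k + r ^ 2 * ((x + c * s) + -v * s) ^ k) := fun k n => by
    rw [corrMoment, walkExp_succ]
    congr 1
    ext x s
    rw [hc]
    ring_nf
  clear_value c v
  induction L using Nat.strong_induction_on with
  | _ L ih =>
  match L, ih with
  | 0, _ => simp [corrMoment, walkExp_one a r t _ hrt, gaussMoment]
  | 1, _ =>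
    have hconst : ∀ n, corrMoment a r t c 1 n = corrMoment a r t c 1 0 := fun n => by
      induction n with
      | zero => rfl
      | succ n ih =>
        rw [← ih, hstep, corrMoment]
        congr 1
        ext x s
        linear_combination (x + c * s) * hrt - s * hrv
    refine tendsto_div_rpow_zero_of_le (p := 0) (C := |corrMoment a r t c 1 0|) (by norm_num)
      fun n => ?_
    simp [hconst n]
  | l + 2, ih =>
    set G : ℕ → ℝ → ℝ := fun j s =>
      (t ^ 2 * s ^ (l + 2 - j) + r ^ 2 * (-v * s) ^ (l + 2 - j)) * (l + 2).choose j with hG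
    have hinc : ∀ n, corrMoment a r t c (l + 2) (n + 1) - corrMoment a r t c (l + 2) n =
        (l + 2) * (l + 1) / 2 * v * corrMoment a r t c l n +
          walkExp a r t n (fun x s => ∑ j ∈ Finset.range l, G j s * (x + c * s) ^ j) := fun n => by
      rw [sub_eq_iff_eq_add, hstep, corrMoment, corrMoment, ← walkExp_const_mul, ← walkExp_add,
        ← walkExp_add]
      have key : ∀ x s : ℝ, s ^ 2 = 1 →
          t ^ 2 * ((x + c * s) + s) ^ (l + 2) + r ^ 2 * ((x + c * s) + -v * s) ^ (l + 2) =
          (l + 2) * (l + 1) / 2 * v * (x + c * s) ^ l +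
            ∑ j ∈ Finset.range l, G j s * (x + c * s) ^ j + (x + c * s) ^ (l + 2) := by
        intro x s hs
        have hsum : ∑ j ∈ Finset.range l, G j s * (x + c * s) ^ j =
            t ^ 2 * ∑ j ∈ Finset.range l, (s ^ (l + 2 - j) * (l + 2).choose j) * (x + c * s) ^ j +
            r ^ 2 * ∑ j ∈ Finset.range l,
              ((-v * s) ^ (l + 2 - j) * (l + 2).choose j) * (x + c * s) ^ j := by
          rw [Finset.mul_sum, Finset.mul_sum, ← Finset.sum_add_distrib]
          exact Finset.sum_congr rfl fun j _ => by rw [hG]; ring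
        rw [add_pow_add_two (x + c * s) s, add_pow_add_two (x + c * s) (-v * s), hsum]
        have hvar : t ^ 2 + r ^ 2 * v ^ 2 = v := by
          linear_combination (v - 1) * hrv + v * hrt
        linear_combination (x + c * s) ^ (l + 2) * hrt -
          (l + 2) * s * (x + c * s) ^ (l + 1) * hrv +
          (l + 2) * (l + 1) / 2 * (x + c * s) ^ l * (s ^ 2 * hvar + v * hs)
      exact walkExp_congr a r t n (fun x => key x 1 (by norm_num))
        (fun x => key x (-1) (by norm_num))
    have hlim : Tendsto (fun n : ℕ => (corrMoment a r t c (l + 2) (n + 1) -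
        corrMoment a r t c (l + 2) n) / ((n : ℝ) + 1) ^ (((l + 2 : ℕ) : ℝ) / 2 - 1)) atTop
        (nhds ((l + 2) * (l + 1) / 2 * v * gaussMoment v l)) := by
      have := ((ih l (by omega)).const_mul ((l + 2) * (l + 1) / 2 * v)).add
        (tendsto_walkExp_lower_terms (l := l) ha0 ha1 (fun j hj => ih j (by omega)) G)
      rw [add_zero] at this
      refine this.congr fun n => ?_
      have hq : ((l + 2 : ℕ) : ℝ) / 2 - 1 = (l : ℝ) / 2 := by push_cast; ring
      rw [hinc, hq, add_div]
      ring
    have := tendsto_div_rpow_of_tendsto_increment (by positivity) hlim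
    convert this using 2
    rw [gaussMoment]
    push_cast
    field_simp

lemma tendsto_walkExp_pow (ha0 : 0 ≤ a) (ha1 : a ≤ 1) (hr : r ≠ 0) (hrt : r ^ 2 + t ^ 2 = 1)
    (L : ℕ) :
    Tendsto (fun n : ℕ => walkExp a r t n (fun x _ => x ^ L) / ((n : ℝ) + 1) ^ ((L : ℝ) / 2))
      atTop (nhds (gaussMoment (t ^ 2 / r ^ 2) L)) := by
  have h := tendsto_corrMoment ha0 ha1 hr hrt
  set c := (t ^ 2 / r ^ 2 - 1) / 2
  have := (tendsto_walkExp_lower_terms ha0 ha1 (l := L) (fun j _ => h j)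
    (fun j s => (-(c * s)) ^ (L - j) * L.choose j)).add (h L)
  rw [zero_add] at this
  refine this.congr fun n => ?_
  rw [← add_div, corrMoment, ← walkExp_add]
  congr 2
  ext x s
  rw [← add_pow_eq_sum_lower, add_neg_cancel_right]

end moments

lemma sum_mul_w (a r t : ℝ) (n : ℕ) (f : ℤ → ℂ) :
    ∑ k ∈ Finset.Icc (-(n : ℤ)) n, f k * (w a r t n k : ℂ) =
      ∑ σ : Fin n → Bool, f (∑ j, sgn (σ j)) * (prw a r t σ : ℂ) := by
  simp only [w, Complex.ofReal_sum, Finset.mul_sum]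
  rw [Finset.sum_comm]
  refine Finset.sum_congr rfl fun σ _ => ?_
  have hmem : ∑ j, sgn (σ j) ∈ Finset.Icc (-(n : ℤ)) n := by
    rw [Finset.mem_Icc, ← abs_le]
    refine (Finset.abs_sum_le_sum_abs _ _).trans ?_
    have : ∀ j, |sgn (σ j)| = 1 := fun j => by
      rcases sgn_eq_one_or_neg_one (σ j) with h | h <;> simp [h]
    simp [this]
  rw [Finset.sum_eq_single_of_mem _ hmem fun k _ hk => by simp [hk.symm]]
  simp

/-- Corollary 4.5: convergence of all rescaled moments of the persistent random walk to
Gaussian moments: `Σ_{k=-τ}^{τ} (ik)^L τ^{-L/2} w_k(τ) → (t²/r²)^{L/2} H_L(0) (-1)^L`,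
where `H_L` is the (probabilists') Hermite polynomial
`H_L(z) = (-1)^L e^{z²/2}(d/dz)^L e^{-z²/2}`. -/
theorem moments_gaussian_limit
    (r t : ℝ) (hr0 : 0 < r) (hr1 : r < 1) (ht0 : 0 < t) (ht1 : t < 1)
    (hrt : r ^ 2 + t ^ 2 = 1) (a : ℝ) (ha0 : 0 ≤ a) (ha1 : a ≤ 1) :
    ∀ L : ℕ, Tendsto
      (fun τ : ℕ => ∑ k ∈ Finset.Icc (-(τ : ℤ)) (τ : ℤ),
        (Complex.I * k) ^ L * (((τ : ℝ) ^ (-(L : ℝ) / 2) : ℝ) : ℂ) * (w a r t τ k : ℂ))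
      atTop
      (nhds ((((t ^ 2 / r ^ 2 : ℝ) ^ ((L : ℝ) / 2) *
          ((Polynomial.hermite L).eval 0 : ℤ) * (-1) ^ L : ℝ) : ℂ))) := by
  intro L
  rw [← I_pow_mul_gaussMoment, ← tendsto_add_atTop_iff_nat 1]
  refine ((Complex.continuous_ofReal.tendsto _).comp
    (tendsto_walkExp_pow ha0 ha1 hr0.ne' hrt L) |>.const_mul (Complex.I ^ L)).congr fun n => ?_
  rw [sum_mul_w a r t (n + 1)
    (fun k => (Complex.I * k) ^ L * ((((n + 1 : ℕ) : ℝ) ^ (-(L : ℝ) / 2) : ℝ) : ℂ))]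
  have hpos : (0 : ℝ) ≤ (n : ℝ) + 1 := by positivity
  rw [Function.comp, walkExp, div_eq_mul_inv, ← Real.rpow_neg hpos, ← neg_div,
    Complex.ofReal_mul, Complex.ofReal_sum, Finset.sum_mul, Finset.mul_sum]
  refine Finset.sum_congr rfl fun σ _ => ?_
  push_cast
  rw [mul_pow]
  ring

end QWStmt17
end
end

section
/- Let V ⊆ ℝ⁴ be a linear subspace that is invariant under each of the four matrices T₁, T₂, T₃, T₄ (i.e. T_j V ⊆ V for j = 1, 2, 3, 4). Then V = {0} or V = ℝ⁴. -/
open Matrix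

noncomputable section

namespace QWStmt19

/-- Lemma on irreducibility: the only subspaces of `ℝ⁴` invariant under all four
coefficient matrices `T₁, T₂, T₃, T₄` of the realified transfer matrices are `{0}` and `ℝ⁴`. -/
theorem invariant_subspaces_trivial
    (R r t : ℝ) (hR : 0 < R) (hr0 : 0 < r) (hr1 : r < 1) (ht0 : 0 < t) (ht1 : t < 1)
    (hrt : r ^ 2 + t ^ 2 = 1)
    (T₁ T₂ T₃ T₄ : Matrix (Fin 4) (Fin 4) ℝ)
    (hT₁ : T₁ = R ^ 2 • !![1, 0, 0, 0; 0, 1, 0, 0; 0, 0, 0, 0; 0, 0, 0, 0])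
    (hT₂ : T₂ = R ^ 2 • !![0, 1, 0, 0; -1, 0, 0, 0; 0, 0, 0, 0; 0, 0, 0, 0])
    (hT₃ : T₃ = !![r ^ 2, 0, -(r * t), 0; 0, r ^ 2, 0, -(r * t);
                   -(r * t), 0, t ^ 2, 0; 0, -(r * t), 0, t ^ 2])
    (hT₄ : T₄ = !![0, -(r ^ 2), 0, r * t; r ^ 2, 0, -(r * t), 0;
                   0, r * t, 0, -(t ^ 2); -(r * t), 0, t ^ 2, 0])
    (V : Submodule ℝ (Fin 4 → ℝ))
    (hV : ∀ v ∈ V, T₁.mulVec v ∈ V ∧ T₂.mulVec v ∈ V ∧ T₃.mulVec v ∈ V ∧ T₄.mulVec v ∈ V) :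
    V = ⊥ ∨ V = ⊤ := by
  subst hT₁ hT₂ hT₃ hT₄
  have hR0 : R ≠ 0 := hR.ne'
  have hr : r ≠ 0 := hr0.ne'
  have ht : t ≠ 0 := ht0.ne'
  have first_mem : ∀ v ∈ V, v 0 ^ 2 + v 1 ^ 2 ≠ 0 → ![1, 0, 0, 0] ∈ V := by
    intro v hv hne
    obtain ⟨h₁, h₂, -, -⟩ := hV v hv
    convert V.add_mem (V.smul_mem (v 0 / (R ^ 2 * (v 0 ^ 2 + v 1 ^ 2))) h₁)
      (V.smul_mem (v 1 / (R ^ 2 * (v 0 ^ 2 + v 1 ^ 2))) h₂) using 1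
    ext i
    fin_cases i <;> simp [dotProduct, Fin.sum_univ_four] <;> field_simp
    ring
  have top_of_first_mem : ![1, 0, 0, 0] ∈ V → V = ⊤ := by
    intro h
    obtain ⟨-, h₂, h₃, h₄⟩ := hV _ h
    have second_mem : ![0, 1, 0, 0] ∈ V := by
      convert V.smul_mem (-(R ^ 2)⁻¹) h₂ using 1
      ext i
      fin_cases i <;> simp [hR0]
    rw [eq_top_iff]
    intro w _
    convert V.add_mem (V.add_mem (V.smul_mem (w 0 + r * w 2 / t) h)
      (V.smul_mem (w 1 + r * w 3 / t) second_mem))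
      (V.add_mem (V.smul_mem (-w 2 / (r * t)) h₃) (V.smul_mem (-w 3 / (r * t)) h₄)) using 1
    ext i
    fin_cases i <;> simp <;> field_simp <;> ring
  refine or_iff_not_imp_left.mpr fun hbot => top_of_first_mem ?_
  obtain ⟨v, hv, hv0⟩ := V.ne_bot_iff.mp hbot
  by_cases h : v 0 ^ 2 + v 1 ^ 2 = 0
  · have h0 : v 0 = 0 := by nlinarith [sq_nonneg (v 0), sq_nonneg (v 1)]
    have h1 : v 1 = 0 := by nlinarith [sq_nonneg (v 0), sq_nonneg (v 1)]
    refine first_mem _ (hV v hv).2.2.1 fun h' => hv0 ?_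
    simp [Matrix.mulVec, dotProduct, Fin.sum_univ_four, h0, h1] at h'
    have hsum : (r * t) ^ 2 * (v 2 ^ 2 + v 3 ^ 2) = 0 := by linarith
    have hsum' : v 2 ^ 2 + v 3 ^ 2 = 0 := by simpa [hr, ht] using hsum
    have h2 : v 2 = 0 := by nlinarith [sq_nonneg (v 2), sq_nonneg (v 3)]
    have h3 : v 3 = 0 := by nlinarith [sq_nonneg (v 2), sq_nonneg (v 3)]
    ext i
    fin_cases i <;> simp [h0, h1, h2, h3]
  · exact first_mem v hv h

end QWStmt19
end
end
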